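/- New sum rule from the Gross–Witten sum rule via the Delsarte–Genin map: Let −1 ≤ g ≤ 0 and let ρ_g = |g|·SC + (1−|g|)·Arcsine. For every nontrivial symmetric probability measure μ on [−2,2] with canonical moments (u_k)_{k≥1} (so u_{2k+1} = 0 for all k) and u₀ = −1: K(ρ_g | μ) = H(g) + g/2 − (g/2)·∑_{k=1}^∞ (u_{2k} − u_{2k−2})² + ∑_{k=1}^∞ [−log(1−u_{2k}²) + g·u_{2k}²], where H(g) = 1 − √(1−g²) + log((1+√(1−g²))/2), and where both sides may be infinite simultaneously. -/

import Mathlib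

open MeasureTheory Real Filter Set Topology Polynomial
open scoped ENNReal ComplexConjugate

noncomputable section

namespace SumRules

-- Kullback–Leibler divergence `K(ν | μ)`.
open Classical in
def KLdiv {α : Type*} [MeasurableSpace α] (ν μ : Measure α) : ℝ≥0∞ :=
  if ν ≪ μ ∧ Integrable (llr ν μ) ν then ENNReal.ofReal (∫ x, llr ν μ x ∂ν) else ⊤

/-- The (topological) support of a measure. -/
def suppSet {α : Type*} [TopologicalSpace α] [MeasurableSpace α] (μ : Measure α) : Set α :=
  {x | ∀ U ∈ nhds x, μ U ≠ 0}

/-- A measure is nontrivial if its support is infinite, i.e. it is not carried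
by any finite set. -/
def InfiniteSupport {α : Type*} [MeasurableSpace α] (μ : Measure α) : Prop :=
  ∀ s : Finset α, μ (↑s : Set α)ᶜ ≠ 0

/-- The set of support points outside `[cm, cp]`. -/
def ES (μ : Measure ℝ) (cm cp : ℝ) : Set ℝ := suppSet μ \ Icc cm cp

/-- `μ ∈ 𝒮₁(cm, cp)`: the support of `μ` is contained in `[cm, cp]` together with an
at most countable set of points outside this interval. -/
def InS1 (μ : Measure ℝ) (cm cp : ℝ) : Prop := (ES μ cm cp).Countable

/-- `a b` (indexed so that `a (k+1) = a_{k+1}`, `b (k+1) = b_{k+1}`, `k ≥ 0`) are the Jacobi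
coefficients of `μ`: there is a sequence of orthonormal polynomials (with positive leading
coefficients, obtained by Gram-Schmidt from `1, x, x², …`) satisfying the three-term recursion. -/
def IsJacobi (μ : Measure ℝ) (a b : ℕ → ℝ) : Prop :=
  (∀ k : ℕ, 0 < a (k+1)) ∧
  ∃ p : ℕ → Polynomial ℝ,
    (∀ k, (p k).natDegree = k) ∧ (∀ k, 0 < (p k).leadingCoeff) ∧
    (∀ j k, ∫ x, (p j).eval x * (p k).eval x ∂μ = if j = k then 1 else 0) ∧
    (∀ (k : ℕ) (x : ℝ), x * (p k).eval x =
      a (k+1) * (p (k+1)).eval x + b (k+1) * (p k).eval x +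
        (if k = 0 then 0 else a k * (p (k-1)).eval x))

/-- `u` is the sequence of canonical moments of a measure on `[-2,2]` (with `u 0 = -1`). -/
def IsCanonicalMoments (μ : Measure ℝ) (u : ℕ → ℝ) : Prop :=
  u 0 = -1 ∧ (∀ k : ℕ, u (k+1) ∈ Ioo (-1 : ℝ) 1) ∧
  ∃ a b : ℕ → ℝ, IsJacobi μ a b ∧
    (∀ k : ℕ, b (k+1) = (1 - u (2*k)) * u (2*k+1) - (1 + u (2*k)) * u (2*k-1)) ∧
    (∀ k : ℕ, (a (k+1))^2 = (1 - u (2*k)) * (1 - (u (2*k+1))^2) * (1 + u (2*k+2)))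

/-- `z` is the sequence of canonical coefficients of a measure supported in `[0,∞)`. -/
def IsCanonicalZ (μ : Measure ℝ) (z : ℕ → ℝ) : Prop :=
  z 0 = 0 ∧ (∀ k : ℕ, 0 ≤ z (k+1)) ∧
  ∃ a b : ℕ → ℝ, IsJacobi μ a b ∧
    (∀ k : ℕ, b (k+1) = z (2*k) + z (2*k+1)) ∧
    (∀ k : ℕ, (a (k+1))^2 = z (2*k+1) * z (2*k+2))

def Gfun (x : ℝ) : ℝ := x - 1 - Real.log x

/-- The semicircle law. -/
def SCm : Measure ℝ :=
  volume.withDensity fun x => ENNReal.ofReal (Real.sqrt (4 - x^2) / (2*π))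

/-- The arcsine law on `(-2,2)`. -/
def ArcsineM : Measure ℝ :=
  volume.withDensity fun x => ENNReal.ofReal (1 / (π * Real.sqrt (4 - x^2)))

/-- The measure with density `(2/(π|q-p|)) √((x-p)/(q-x))` between `p` and `q`. -/
def Dmeas (p q : ℝ) : Measure ℝ :=
  volume.withDensity fun x => ENNReal.ofReal (2/(π * |q - p|) * Real.sqrt ((x - p)/(q - x)))

/-- The point `e^{iθ}` on the unit circle. -/
def ctheta (θ : ℝ) : ℂ := Complex.exp (θ * Complex.I)

/-- Reversed polynomial `Φ*` with conjugated coefficients: `Φ*(z) = z^k conj(Φ(1/conj z))`. -/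
def polyStar (P : Polynomial ℂ) : Polynomial ℂ := (P.map (starRingEnd ℂ)).reverse

/-- `α` is the sequence of Verblunsky coefficients of the measure `ν` on the unit circle
(`ν` being given in angle coordinates, carried by `[0, 2π)`): the monic orthogonal
polynomials of `ν` satisfy the Szegő recursion with coefficients `α`. -/
def IsVerblunsky (ν : Measure ℝ) (α : ℕ → ℂ) : Prop :=
  (∀ k, ‖α k‖ < 1) ∧
  ∃ Φ : ℕ → Polynomial ℂ,
    (∀ k, (Φ k).Monic) ∧ (∀ k, (Φ k).natDegree = k) ∧
    (∀ j k, j ≠ k →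
      ∫ θ, conj ((Φ j).eval (ctheta θ)) * (Φ k).eval (ctheta θ) ∂ν = 0) ∧
    (∀ k, Φ (k+1) = Polynomial.X * Φ k - Polynomial.C (conj (α k)) * polyStar (Φ k))

/-- `γ` is the sequence of deformed Verblunsky coefficients of `ν`. -/
def IsDeformedVerblunsky (ν : Measure ℝ) (γ : ℕ → ℂ) : Prop :=
  ∃ α : ℕ → ℂ, IsVerblunsky ν α ∧
    ∀ k : ℕ, γ k = conj (α k) * ∏ j ∈ Finset.range k, (1 - conj (γ j)) / (1 - γ j)

/-- Symmetry of a measure on the circle (in angle coordinates): invariance under conjugation. -/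
def SymmCircle (ν : Measure ℝ) : Prop :=
  (ν.map ctheta).map (starRingEnd ℂ) = ν.map ctheta

/-- The uniform measure on the circle, in angle coordinates. -/
def UNIFm : Measure ℝ :=
  volume.withDensity fun θ => ENNReal.ofReal (if 0 ≤ θ ∧ θ < 2*π then 1/(2*π) else 0)

end SumRules

namespace SumRules

/-- Outlier contribution for the Killip–Simon sum rule (`+∞` inside `(-2,2)`). -/
def FSC (x : ℝ) : ℝ≥0∞ :=
  if 2 ≤ |x| then
    ENNReal.ofReal (|x|/2 * Real.sqrt (x^2 - 4) - 2 * Real.log ((|x| + Real.sqrt (x^2 - 4))/2))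
  else ⊤

/-- Coefficient side of the Killip–Simon sum rule. -/
def IH (a b : ℕ → ℝ) : ℝ≥0∞ :=
  (1/2 : ℝ≥0∞) * ∑' k : ℕ, ENNReal.ofReal ((b (k+1))^2)
    + ∑' k : ℕ, ENNReal.ofReal (Gfun ((a (k+1))^2))

def tauM (τ : ℝ) : ℝ := (1 - Real.sqrt τ)^2
def tauP (τ : ℝ) : ℝ := (1 + Real.sqrt τ)^2

/-- The Marchenko–Pastur law with parameter `τ`. -/
def MPm (τ : ℝ) : Measure ℝ :=
  volume.withDensity fun x =>
    ENNReal.ofReal (Real.sqrt ((x - tauM τ) * (tauP τ - x)) / (2*π*τ*x))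

/-- Outlier contribution for the Marchenko–Pastur sum rule. -/
def FMP (τ : ℝ) (x : ℝ) : ℝ≥0∞ :=
  if tauP τ ≤ x then
    ENNReal.ofReal (∫ t in (tauP τ)..x, Real.sqrt ((t - tauP τ) * (t - tauM τ)) / (τ*t))
  else if 0 < x ∧ x ≤ tauM τ then
    ENNReal.ofReal (∫ t in x..(tauM τ), Real.sqrt ((t - tauP τ) * (t - tauM τ)) / (τ*t))
  else ⊤

/-- Coefficient side of the Marchenko–Pastur sum rule. -/
def IL (τ : ℝ) (z : ℕ → ℝ) : ℝ≥0∞ :=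
  ∑' k : ℕ, ENNReal.ofReal (τ⁻¹ * Gfun (z (2*k+1)) + Gfun (τ⁻¹ * z (2*k+2)))

def uPl (κ₁ κ₂ : ℝ) : ℝ :=
  2*(κ₂^2 - κ₁^2 + 4*Real.sqrt ((1+κ₁)*(1+κ₂)*(1+κ₁+κ₂)))/(2+κ₁+κ₂)^2
def uMi (κ₁ κ₂ : ℝ) : ℝ :=
  2*(κ₂^2 - κ₁^2 - 4*Real.sqrt ((1+κ₁)*(1+κ₂)*(1+κ₁+κ₂)))/(2+κ₁+κ₂)^2

/-- The Kesten–McKay law with parameters `κ₁, κ₂`. -/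
def KMKm (κ₁ κ₂ : ℝ) : Measure ℝ :=
  volume.withDensity fun x =>
    ENNReal.ofReal ((2+κ₁+κ₂)/(2*π) * Real.sqrt ((x - uMi κ₁ κ₂) * (uPl κ₁ κ₂ - x)) / (4 - x^2))

def ue (κ₁ κ₂ : ℝ) : ℝ := -(κ₁+κ₂)/(2+κ₁+κ₂)
def uo (κ₁ κ₂ : ℝ) : ℝ := (κ₂-κ₁)/(2+κ₁+κ₂)

def He (κ₁ κ₂ u : ℝ) : ℝ :=
  -(1+κ₁+κ₂) * Real.log ((1-u)/(1 - ue κ₁ κ₂)) - Real.log ((1+u)/(1 + ue κ₁ κ₂))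
def Ho (κ₁ κ₂ u : ℝ) : ℝ :=
  -(1+κ₁) * Real.log ((1-u)/(1 - uo κ₁ κ₂)) - (1+κ₂) * Real.log ((1+u)/(1 + uo κ₁ κ₂))

/-- Coefficient side of the Kesten–McKay sum rule. -/
def IJ (κ₁ κ₂ : ℝ) (u : ℕ → ℝ) : ℝ≥0∞ :=
  ∑' k : ℕ, (ENNReal.ofReal (Ho κ₁ κ₂ (u (2*k+1))) + ENNReal.ofReal (He κ₁ κ₂ (u (2*k+2))))

/-- Outlier contribution for the Kesten–McKay sum rule. -/
def FKMK (κ₁ κ₂ : ℝ) (x : ℝ) : ℝ≥0∞ :=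
  if uPl κ₁ κ₂ ≤ x then
    ENNReal.ofReal (∫ t in (uPl κ₁ κ₂)..x,
      (2+κ₁+κ₂) * Real.sqrt ((t - uPl κ₁ κ₂) * (t - uMi κ₁ κ₂)) / (4 - t^2))
  else if x ≤ uMi κ₁ κ₂ then
    ENNReal.ofReal (∫ t in x..(uMi κ₁ κ₂),
      (2+κ₁+κ₂) * Real.sqrt ((t - uPl κ₁ κ₂) * (t - uMi κ₁ κ₂)) / (4 - t^2))
  else ⊤

def Hgw (g : ℝ) : ℝ := 1 - Real.sqrt (1 - g^2) + Real.log ((1 + Real.sqrt (1 - g^2))/2)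

def thetaG (g : ℝ) : ℝ := 2 * Real.arcsin (Real.sqrt (1/|g|))

/-- The Gross–Witten measures, in angle coordinates. -/
def GWm (g : ℝ) : Measure ℝ :=
  if |g| ≤ 1 then
    volume.withDensity fun θ =>
      ENNReal.ofReal (if 0 ≤ θ ∧ θ < 2*π then (1 + g * Real.cos θ)/(2*π) else 0)
  else if g < -1 then
    volume.withDensity fun θ => ENNReal.ofReal (
      if π - thetaG g ≤ θ ∧ θ ≤ π + thetaG g then
        |g| / π * Real.sin (θ/2) * Real.sqrt (Real.sin (θ/2)^2 - Real.cos (thetaG g/2)^2)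
      else 0)
  else
    volume.withDensity fun θ => ENNReal.ofReal (
      if -thetaG g ≤ θ ∧ θ ≤ thetaG g then
        g/π * Real.cos (θ/2) * Real.sqrt (Real.sin (thetaG g/2)^2 - Real.sin (θ/2)^2)
      else 0)

def thetaD (d : ℝ) : ℝ := 2 * Real.arcsin (d/(1+d))
def gammaD (d : ℝ) : ℝ := -d/(1+d)

/-- The Hua–Pickrell measure, in angle coordinates. -/
def HPm (d : ℝ) : Measure ℝ :=
  volume.withDensity fun θ => ENNReal.ofReal (
    if thetaD d < θ ∧ θ < 2*π - thetaD d then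
      (1+d) * Real.sqrt (Real.sin (θ/2)^2 - Real.sin (thetaD d/2)^2) / (2*π*Real.sin (θ/2))
    else 0)

/-- The entropy-like function appearing in the Hua–Pickrell sum rule. -/
def HHP (d : ℝ) (γ : ℂ) : ℝ :=
  -Real.log ((1 - ‖γ‖^2)/(1 - (gammaD d)^2)) - 2*d*Real.log (‖1 - γ‖/(1 - gammaD d))

/-- Outlier contribution for the Hua–Pickrell sum rule (in angle coordinates). -/
def FHP (d : ℝ) (θ : ℝ) : ℝ≥0∞ :=
  if θ ≤ thetaD d then
    ENNReal.ofReal (∫ φ in θ..(thetaD d),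
      (1+d) * Real.sqrt (Real.sin (thetaD d/2)^2 - Real.sin (φ/2)^2) / Real.sin (φ/2))
  else if 2*π - thetaD d ≤ θ then
    ENNReal.ofReal (∫ φ in (2*π - thetaD d)..θ,
      (1+d) * Real.sqrt (Real.sin (thetaD d/2)^2 - Real.sin (φ/2)^2) / Real.sin (φ/2))
  else ⊤

/-- Set of outlying support points for a measure on the circle, in angle coordinates. -/
def EST (ν : Measure ℝ) (tm tp : ℝ) : Set ℝ := suppSet ν \ Icc tm tp

/-- `ν ∈ 𝒮₁^𝕋(tm, tp)` (in angle coordinates). -/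
def InS1T (ν : Measure ℝ) (tm tp : ℝ) : Prop := (EST ν tm tp).Countable

/-- The measure `𝒟(2,-2)`, with density `(1/2π)√((2-x)/(2+x))` on `(-2,2)`
(a shift of the hard-edge Marchenko–Pastur law). -/
def Dhard : Measure ℝ :=
  volume.withDensity fun x => ENNReal.ofReal (Real.sqrt ((2 - x)/(2 + x)) / (2*π))

/-- The mixture `μ_g = |g| 𝒟(2,-2) + (1-|g|) Arcsine`. -/
def mugMix (g : ℝ) : Measure ℝ :=
  ENNReal.ofReal |g| • Dhard + ENNReal.ofReal (1 - |g|) • ArcsineM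

/-- The mixture `ρ_g = |g| SC + (1-|g|) Arcsine`. -/
def rhog (g : ℝ) : Measure ℝ :=
  ENNReal.ofReal |g| • SCm + ENNReal.ofReal (1 - |g|) • ArcsineM

def Cg (g : ℝ) : ℝ :=
  -|g| * (1 - Real.log 2) + 1 - Real.sqrt (1 - g^2) + Real.log ((1 + Real.sqrt (1 - g^2))/2)

/-- The measure with density `(1/2π)(2+x)^{3/2}(2-x)^{1/2}` on `[-2,2]`. -/
def muHat : Measure ℝ :=
  volume.withDensity fun x =>
    ENNReal.ofReal ((2 + x) * Real.sqrt (2 + x) * Real.sqrt (2 - x) / (2*π))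

/-- The Poisson kernel measure `Pois(ζ)`, in angle coordinates. -/
def PoisM (ζ : ℂ) : Measure ℝ :=
  volume.withDensity fun θ => ENNReal.ofReal (
    if 0 ≤ θ ∧ θ < 2*π then (1 - ‖ζ‖^2)/(2*π*‖ctheta θ - ζ‖^2) else 0)

/-- The Carathéodory function of a measure on the circle (angle coordinates). -/
def Cara (ν : Measure ℝ) (z : ℂ) : ℂ := ∫ θ, (ctheta θ + z)/(ctheta θ - z) ∂ν

/-- `f` is the Schur function of `ν`. -/
def IsSchurFn (ν : Measure ℝ) (f : ℂ → ℂ) : Prop :=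
  DifferentiableOn ℂ f (Metric.ball 0 1) ∧
  (∀ z ∈ Metric.ball (0:ℂ) 1, ‖f z‖ ≤ 1) ∧
  (∀ z ∈ Metric.ball (0:ℂ) 1, Cara ν z - 1 = z * f z * (Cara ν z + 1))

/-- Möbius transform of the unit disk. -/
def mtrans (ρ z : ℂ) : ℂ := (z - ρ)/(1 - conj ρ * z)

def npRaw (ρ : ℂ) (g : ℂ → ℂ) (z : ℂ) : ℂ :=
  ((-ρ/(‖ρ‖ : ℂ)) / mtrans ρ z) * ((g z - g ρ)/(1 - conj (g ρ) * g z))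

-- One step of the Nevanlinna–Pick algorithm at `ρ` (the removable singularity at `ρ`
-- is filled in by the limit).
open Classical in
def npStep (ρ : ℂ) (g : ℂ → ℂ) : ℂ → ℂ := fun z =>
  if z = ρ then limUnder (𝓝[≠] ρ) (npRaw ρ g) else npRaw ρ g z

def schurRaw (g : ℂ → ℂ) (z : ℂ) : ℂ := ((g z - g 0)/z)/(1 - conj (g 0) * g z)

-- One step of the classical Schur algorithm (the removable singularity at `0`
-- is filled in by the limit).
open Classical in
def schurStep (g : ℂ → ℂ) : ℂ → ℂ := fun z =>
  if z = 0 then limUnder (𝓝[≠] (0:ℂ)) (schurRaw g) else schurRaw g z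

def xdHP (d : ℝ) : ℝ := 2*(1 + 2*d - d^2)/(1+d)^2

def uKMK (d : ℝ) : ℝ := 2*Real.sqrt (1 + 2*d)/(1+d)

end SumRules

namespace SumRules

/-! ### Part A: algebra of the recursions -/

/-- Pair of Szegő polynomials (evaluated), `(Φ_n(Z), Φ_n^*(Z))`. -/
def Ph (v : ℕ → ℝ) (Z : ℂ) : ℕ → ℂ × ℂ
  | 0 => (1, 1)
  | n+1 => (Z * (Ph v Z n).1 - v (n+1) * (Ph v Z n).2,
            (Ph v Z n).2 - v (n+1) * (Z * (Ph v Z n).1))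

def phi (v : ℕ → ℝ) (n : ℕ) (Z : ℂ) : ℂ := (Ph v Z n).1
def phs (v : ℕ → ℝ) (n : ℕ) (Z : ℂ) : ℂ := (Ph v Z n).2

lemma phi_zero (v : ℕ → ℝ) (Z : ℂ) : phi v 0 Z = 1 := rfl
lemma phs_zero (v : ℕ → ℝ) (Z : ℂ) : phs v 0 Z = 1 := rfl
lemma phi_succ (v : ℕ → ℝ) (n : ℕ) (Z : ℂ) :
    phi v (n+1) Z = Z * phi v n Z - v (n+1) * phs v n Z := rfl
lemma phs_succ (v : ℕ → ℝ) (n : ℕ) (Z : ℂ) :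
    phs v (n+1) Z = phs v n Z - v (n+1) * (Z * phi v n Z) := rfl

lemma phi_diff (v : ℕ → ℝ) (n : ℕ) : Differentiable ℂ (phi v n) ∧ Differentiable ℂ (phs v n) := by
  induction n with
  | zero =>
    exact ⟨differentiable_const (1:ℂ), differentiable_const (1:ℂ)⟩
  | succ n ih =>
    obtain ⟨h1, h2⟩ := ih
    constructor
    · have : phi v (n+1) = fun Z => Z * phi v n Z - v (n+1) * phs v n Z := by
        funext Z; exact phi_succ v n Z
      rw [this]; fun_prop
    · have : phs v (n+1) = fun Z => phs v n Z - v (n+1) * (Z * phi v n Z) := by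
        funext Z; exact phs_succ v n Z
      rw [this]; fun_prop

lemma phi_at_zero (v : ℕ → ℝ) (h0 : v 0 = -1) (n : ℕ) :
    phi v n 0 = -(v n : ℂ) ∧ phs v n 0 = 1 := by
  induction n with
  | zero => simp [phi_zero, phs_zero, h0]
  | succ n ih => simp [phi_succ, phs_succ, ih.2]

/-- Schur-type bounds in the closed disc. -/
lemma phs_bound (v : ℕ → ℝ) (hv : ∀ n, |v (n+1)| < 1) (Z : ℂ) (hZ : ‖Z‖ ≤ 1) (n : ℕ) :
    ‖phi v n Z‖ ≤ ‖phs v n Z‖ ∧ phs v n Z ≠ 0 := by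
  induction n with
  | zero => simp [phi_zero, phs_zero]
  | succ n ih =>
    obtain ⟨h1, h2⟩ := ih
    have hpos : 0 < ‖phs v n Z‖ := norm_pos_iff.mpr h2
    have h3 : ‖Z * phi v n Z‖ ≤ ‖phs v n Z‖ := by
      rw [norm_mul]
      calc ‖Z‖ * ‖phi v n Z‖ ≤ 1 * ‖phi v n Z‖ := by gcongr
        _ ≤ _ := by simpa using h1
    set A := Z * phi v n Z
    set B := phs v n Z
    rw [phi_succ, phs_succ]
    change ‖A - v (n+1) * B‖ ≤ ‖B - v (n+1) * A‖ ∧ B - v (n+1) * A ≠ 0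
    have hv1 := hv n
    constructor
    · rw [← sq_le_sq₀ (norm_nonneg _) (norm_nonneg _)]
      rw [← sq_le_sq₀ (norm_nonneg _) (norm_nonneg _)] at h3
      rw [← Complex.normSq_eq_norm_sq, ← Complex.normSq_eq_norm_sq] at h3 ⊢
      simp only [Complex.normSq_apply, Complex.sub_re, Complex.sub_im, Complex.mul_re,
        Complex.mul_im, Complex.ofReal_re, Complex.ofReal_im] at h3 ⊢
      have : (v (n+1))^2 ≤ 1 := by
        rw [sq_le_one_iff_abs_le_one]; exact hv1.le
      nlinarith [mul_nonneg (sub_nonneg.mpr this) (sub_nonneg.mpr h3)]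
    · intro h
      have h4 : B = v (n+1) * A := sub_eq_zero.mp h
      have h5 : ‖B‖ = |v (n+1)| * ‖A‖ := by
        conv_lhs => rw [h4]
        rw [norm_mul, Complex.norm_real, Real.norm_eq_abs]
      nlinarith [abs_nonneg (v (n+1)), norm_nonneg A]

/-- On the unit circle `Φ^* (Z)= Z^n conj Φ(Z)`. -/
lemma phs_circle (v : ℕ → ℝ) (Z : ℂ) (hZ : Z * conj Z = 1) (n : ℕ) :
    phs v n Z = Z^n * conj (phi v n Z) ∧ phi v n Z = Z^n * conj (phs v n Z) := by
  induction n with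
  | zero => simp [phi_zero, phs_zero]
  | succ n ih =>
    obtain ⟨h1, h2⟩ := ih
    rw [phi_succ, phs_succ]
    simp only [map_sub, map_mul, Complex.conj_ofReal]
    constructor
    · calc phs v n Z - v (n+1) * (Z * phi v n Z)
          = (Z * conj Z) * phs v n Z - v (n+1) * (Z * phi v n Z) := by rw [hZ, one_mul]
        _ = (Z * conj Z) * (Z^n * conj (phi v n Z)) -
              v (n+1) * (Z * (Z^n * conj (phs v n Z))) := by rw [← h1, ← h2]
        _ = _ := by ring
    · calc Z * phi v n Z - v (n+1) * phs v n Z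
          = Z * phi v n Z - v (n+1) * ((Z * conj Z) * phs v n Z) := by rw [hZ, one_mul]
        _ = Z * (Z^n * conj (phs v n Z)) - 
              v (n+1) * ((Z * conj Z) * (Z^n * conj (phi v n Z))) := by rw [← h1, ← h2]
        _ = _ := by ring

/-- Monic orthogonal polynomials on the line. -/
def PP (v : ℕ → ℝ) : ℕ → ℝ[X]
  | 0 => 1
  | 1 => X
  | n+2 => X * PP v (n+1) - C ((1 - v n) * (1 + v (n+1))) * PP v n

lemma PP_zero (v : ℕ → ℝ) : PP v 0 = 1 := by rw [PP]
lemma PP_one (v : ℕ → ℝ) : PP v 1 = X := by rw [PP]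
lemma PP_succ (v : ℕ → ℝ) (n : ℕ) :
    PP v (n+2) = X * PP v (n+1) - C ((1 - v n) * (1 + v (n+1))) * PP v n := by rw [PP]

lemma PP_degree (v : ℕ → ℝ) (n : ℕ) :
    ((PP v n).Monic ∧ (PP v n).degree = n) ∧ (PP v (n+1)).Monic ∧ (PP v (n+1)).degree = ((n+1 : ℕ) : WithBot ℕ) := by
  induction n with
  | zero => simp [PP_zero, PP_one, monic_X]
  | succ n ih =>
    obtain ⟨⟨h1, h2⟩, h3, h4⟩ := ih
    refine ⟨⟨h3, h4⟩, ?_⟩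
    have h5 : (X * PP v (n+1)).degree = ((n+2 : ℕ) : WithBot ℕ) := by
      rw [degree_mul, h4, degree_X]; push_cast; ring
    have h6 : (C ((1 - v n) * (1 + v (n+1))) * PP v n).degree < ((n+2 : ℕ) : WithBot ℕ) := by
      refine lt_of_le_of_lt ((degree_mul_le _ _).trans (add_le_add degree_C_le le_rfl)) ?_
      rw [h2, zero_add]; exact_mod_cast (by omega : n < n+2)
    rw [PP_succ]
    constructor
    · apply Monic.sub_of_left (monic_X.mul h3)
      rw [h5]; exact h6
    · rw [degree_sub_eq_left_of_degree_lt (by rw [h5]; exact h6), h5]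

/-- The Bernstein–Szegő denominators as functions on the line. -/
def DD (v : ℕ → ℝ) : ℕ → ℝ → ℝ
  | 0 => fun _ => 1
  | n+1 => fun x => (1 + v (n+1))^2 * DD v n x - v (n+1) * ((PP v (n+1)).eval x)^2

lemma DD_cont (v : ℕ → ℝ) (n : ℕ) : Continuous (DD v n) := by
  induction n with
  | zero => exact continuous_const
  | succ n ih =>
    have : DD v (n+1) = fun x => (1 + v (n+1))^2 * DD v n x - v (n+1) * ((PP v (n+1)).eval x)^2 := rfl
    rw [this]; fun_prop

lemma PP_circle (v : ℕ → ℝ) (h0 : v 0 = -1) (z w : ℂ) (x : ℝ) (hzw : z * w = 1) (hx : (x:ℂ) = z + w) (n : ℕ) :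
    ((1 - v n : ℝ) * (((PP v n).eval x : ℝ) : ℂ) * z^n = phi v n (z^2) + phs v n (z^2)) ∧ 
    (((PP v (n+1)).eval x : ℝ) : ℂ) * z^(n+1) = z^2 * phi v n (z^2) + phs v n (z^2) := by
  induction n with
  | zero => 
    simp only [zero_add, PP_zero, PP_one, h0, phi_zero, phs_zero, hx, eval_one, eval_X]
    constructor
    · push_cast; ring
    · linear_combination hzw
  | succ n ih =>
    obtain ⟨h1, h2⟩ := ih
    rw [phi_succ, phs_succ]
    constructor
    · rw [mul_assoc, h2]; push_cast; ring
    · rw [PP_succ]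
      simp only [eval_sub, eval_mul, eval_X, eval_C]
      push_cast at h1 ⊢
      rw [hx]
      have e : w * z^2 = z := by linear_combination z * hzw
      calc _ = (z^2 + z * w) * ((((PP v (n+1)).eval x : ℝ) : ℂ) * z^(n+1)) 
            - (1 + v (n+1)) * ((1 - v n) * (((PP v n).eval x : ℝ) : ℂ) * z^n) * z^2 := by ring
        _ = _ := by rw [h1, h2, hzw]; ring

lemma DD_circle (v : ℕ → ℝ) (h0 : v 0 = -1) (z : ℂ) (hz : z * conj z = 1) (x : ℝ) 
    (hx : (x:ℂ) = z + conj z) (n : ℕ) : (DD v n x : ℂ) = phs v n (z^2) * conj (phs v n (z^2)) := by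
  induction n with
  | zero => simp [DD, phs_zero]
  | succ n ih =>
    have hZ : z^2 * conj (z^2) = 1 := by rw [map_pow, ← mul_pow, hz, one_pow]
    have h1 := (PP_circle v h0 z (conj z) x hz hx n).2
    have h1' := congrArg conj h1
    simp only [map_mul, Complex.conj_ofReal, map_pow, map_add] at h1'
    have h2 : (((PP v (n+1)).eval x : ℝ) : ℂ)^2 = (z^2 * phi v n (z^2) + phs v n (z^2)) * 
       ((conj z)^2 * conj (phi v n (z^2)) + conj (phs v n (z^2))) := by
      rw [← h1, ← h1']
      calc _ = (((PP v (n+1)).eval x : ℝ) : ℂ)^2 * (z * conj z)^(n+1) := by rw [hz]; simp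
        _ = _ := by ring
    obtain ⟨h3, h4⟩ := phs_circle v (z^2) hZ n
    have h5 : phi v n (z^2) * conj (phi v n (z^2)) = phs v n (z^2) * conj (phs v n (z^2)) := by
      calc _ = (z^2)^n * conj (phs v n (z^2)) * conj (phi v n (z^2)) := by rw [← h4]
        _ = ((z^2)^n * conj (phi v n (z^2))) * conj (phs v n (z^2)) := by ring
        _ = _ := by rw [← h3]
    have h6 : z^2 * (conj z)^2 = 1 := by rw [← mul_pow, hz, one_pow]
    simp only [DD, phs_succ]
    push_cast
    rw [h2, ih]
    simp only [map_sub, map_mul, Complex.conj_ofReal, map_pow]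
    linear_combination (v (n+1) : ℂ)^2 * (- h5 ) + (- (v (n+1) : ℂ) - (v (n+1))^2) * (phi v n (z^2) * conj (phi v n (z^2))) * h6 + (- (v (n+1):ℂ)) * h5

/-! ### Part B: moments of `μ` -/

lemma integrable_of_cont (μ : Measure ℝ) [IsFiniteMeasure μ] (hsupp : μ (Icc (-2) 2)ᶜ = 0)
    (f : ℝ → ℝ) (hf : ContinuousOn f (Icc (-2) 2)) : Integrable f μ := by
  have h1 : μ.restrict (Icc (-2) 2) = μ := by
    apply Measure.restrict_eq_self_of_ae_mem
    rw [ae_iff]; exact hsupp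
  rw [← h1]
  exact hf.integrableOn_compact isCompact_Icc

def dprod (v : ℕ → ℝ) (n : ℕ) : ℝ := ∏ k ∈ Finset.range n, (1 - (v (k+1))^2)

lemma dprod_succ (v : ℕ → ℝ) (n : ℕ) : dprod v (n+1) = dprod v n * (1 - (v (n+1))^2) := by
  rw [dprod, Finset.prod_range_succ]; rfl

lemma dprod_pos (v : ℕ → ℝ) (hv : ∀ n, |v (n+1)| < 1) (n : ℕ) : 0 < dprod v n := by
  apply Finset.prod_pos
  intro k _
  have := (sq_lt_one_iff_abs_lt_one (v (k+1))).mpr (hv k)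
  linarith

structure MomHyp (μ : Measure ℝ) (v : ℕ → ℝ) : Prop where
  v0 : v 0 = -1
  vlt : ∀ n, |v (n+1)| < 1
  m0 : ∀ k, ∫ x, (PP v (k+1)).eval x ∂μ = 0
  m1 : ∀ k, ∫ x, ((PP v (k+1)).eval x)^2 ∂μ = 2 * (1 + v (k+1)) * dprod v k
  m2 : ∀ k, ∫ x, x^2 * ((PP v (k+1)).eval x)^2 ∂μ = 2 * (1 + v (k+1)) * dprod v k *
    ((1 - v k) * (1 + v (k+1)) + (1 - v (k+1)) * (1 + v (k+2)))

lemma momHyp (μ : Measure ℝ) [IsProbabilityMeasure μ] (hsupp : μ (Icc (-2) 2)ᶜ = 0)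
    (u : ℕ → ℝ) (hu : IsCanonicalMoments μ u) (hodd : ∀ k : ℕ, u (2*k+1) = 0) :
    MomHyp μ (fun k => u (2*k)) := by
  obtain ⟨hu0, huI, a, b, ⟨ha, p, hdeg, hlead, horth, hrec⟩, hb, ha2⟩ := hu
  set v : ℕ → ℝ := fun k => u (2*k) with hvdef
  have hv0 : v 0 = -1 := hu0
  have hvlt : ∀ n, |v (n+1)| < 1 := by
    intro n
    have := huI (2*n+1)
    exact abs_lt.mpr this
  have ha2' : ∀ k, (a (k+1))^2 = (1 - v k) * (1 + v (k+1)) := by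
    intro k
    rw [ha2 k, hodd k]
    simp only [hvdef]
    rw [show 2*(k+1) = 2*k+2 by ring]; ring
  have hb' : ∀ k, b (k+1) = 0 := by
    intro k
    rw [hb k, hodd k]
    rcases k with _ | k
    · simp [hu0]
    · rw [show 2*(k+1)-1 = 2*k+1 by omega, hodd k]; ring
  set A : ℕ → ℝ := fun n => ∏ j ∈ Finset.range n, a (j+1) with hA
  have hAs : ∀ n, A (n+1) = A n * a (n+1) := fun n => by
    simp only [hA]; rw [Finset.prod_range_succ]
  have hp0 : ∀ x, (p 0).eval x = 1 := by
    have h1 : p 0 = C ((p 0).coeff 0) := eq_C_of_natDegree_eq_zero (hdeg 0)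
    have h2 := horth 0 0
    have h3 := hlead 0
    rw [h1] at h2 h3
    simp only [eval_C, if_true, integral_const, probReal_univ, smul_eq_mul, one_mul] at h2
    rw [leadingCoeff_C] at h3
    intro x
    rw [h1, eval_C]
    nlinarith
  have hPA : ∀ n, (∀ x, (PP v n).eval x = A n * (p n).eval x) ∧
      (∀ x, (PP v (n+1)).eval x = A (n+1) * (p (n+1)).eval x) := by
    intro n
    induction n with
    | zero =>
      constructor
      · intro x; simp [PP_zero, hp0, hA]
      · intro x
        have := hrec 0 x
        rw [hp0, hb' 0] at this
        simp only [zero_add, PP_one, eval_X, hA, Finset.range_one, Finset.prod_singleton]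
        simpa using this
    | succ n ih =>
      refine ⟨ih.2, fun x => ?_⟩
      have h1 := hrec (n+1) x
      rw [hb' (n+1)] at h1
      simp only [Nat.succ_ne_zero, if_false, Nat.add_sub_cancel, Nat.add_eq_zero_iff, one_ne_zero, and_false] at h1
      rw [PP_succ]
      simp only [eval_sub, eval_mul, eval_X, eval_C]
      rw [ih.1 x, ih.2 x, ← ha2' n, hAs (n+1), hAs n]
      linear_combination (A n * a (n+1)) * h1
  have hPA' : ∀ n x, (PP v n).eval x = A n * (p n).eval x := fun n => (hPA n).1
  have horth' : ∀ j k, ∫ x, (PP v j).eval x * (PP v k).eval x ∂μ = if j = k then (A j)^2 else 0 := by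
    intro j k
    have : ∀ x, (PP v j).eval x * (PP v k).eval x = (A j * A k) * ((p j).eval x * (p k).eval x) := by
      intro x; rw [hPA' j, hPA' k]; ring
    simp_rw [this]
    rw [integral_const_mul, horth j k]
    split_ifs with h
    · subst h; ring
    · ring
  have hAsq : ∀ n, (A (n+1))^2 = 2 * (1 + v (n+1)) * dprod v n := by
    intro n
    induction n with
    | zero =>
      rw [hAs 0]
      have := ha2' 0
      rw [hv0] at this
      simp only [hA, dprod, Finset.range_zero, Finset.prod_empty, one_mul, zero_add] at this ⊢
      rw [this]; ring
    | succ n ih =>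
      rw [hAs (n+1), mul_pow, ih, ha2' (n+1), dprod_succ]; ring
  have hm1 : ∀ k, ∫ x, ((PP v (k+1)).eval x)^2 ∂μ = 2 * (1 + v (k+1)) * dprod v k := by
    intro k
    have := horth' (k+1) (k+1)
    rw [if_pos rfl, hAsq] at this
    rw [← this]; congr 1; funext x; ring
  have hint : ∀ q : ℝ → ℝ, Continuous q → Integrable q μ := fun q hq =>
    integrable_of_cont μ hsupp q hq.continuousOn
  refine ⟨hv0, hvlt, ?_, hm1, ?_⟩
  · intro k
    have := horth' (k+1) 0
    simpa [PP_zero] using this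
  · intro k
    set c := (1 - v k) * (1 + v (k+1)) with hc
    have h1 : ∀ x, x^2 * ((PP v (k+1)).eval x)^2 = ((PP v (k+2)).eval x) * ((PP v (k+2)).eval x)
        + (2 * c) * ((PP v (k+2)).eval x * (PP v k).eval x) +
          c^2 * ((PP v k).eval x * (PP v k).eval x) := by
      intro x
      rw [PP_succ]
      simp only [eval_sub, eval_mul, eval_X, eval_C]
      rw [← hc]; ring
    simp_rw [h1]
    rw [integral_add, integral_add, integral_const_mul, integral_const_mul, horth', horth', horth']
    · rw [if_pos rfl, if_pos rfl, if_neg (by omega), hAs (k+1), mul_pow, ha2' (k+1), ← hAsq k, hAs k, mul_pow, ha2' k, ← hc]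
      ring
    all_goals
      apply hint
      fun_prop

lemma dd_moments (μ : Measure ℝ) [IsProbabilityMeasure μ] (hsupp : μ (Icc (-2) 2)ᶜ = 0)
    (v : ℕ → ℝ) (H : MomHyp μ v) (n : ℕ) :
    ∫ x, DD v n x ∂μ = dprod v n ∧
    ∫ x, x^2 * DD v n x ∂μ = 2 * dprod v n * (1 - v n * v (n+1)) := by
  have hint : ∀ q : ℝ → ℝ, Continuous q → Integrable q μ := fun q hq =>
    integrable_of_cont μ hsupp q hq.continuousOn
  induction n with
  | zero =>
    have h1 := H.m1 0
    simp only [PP_one, zero_add, eval_X, dprod, Finset.range_zero, Finset.prod_empty] at h1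
    simp only [DD, integral_const, probReal_univ, mul_one, dprod, Finset.range_zero, Finset.prod_empty, H.v0, h1, smul_eq_mul, zero_add, true_and]
    ring
  | succ n ih =>
    obtain ⟨h1, h2⟩ := ih
    have hc := DD_cont v n
    constructor
    · simp only [DD]
      rw [integral_sub, integral_const_mul, integral_const_mul, h1, H.m1, dprod_succ]
      · ring
      all_goals
        apply hint
        fun_prop
    · have : ∀ x, x^2 * DD v (n+1) x = (1 + v (n+1))^2 * (x^2 * DD v n x) -
          v (n+1) * (x^2 * ((PP v (n+1)).eval x)^2) := by
        intro x; simp only [DD]; ring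
      simp_rw [this]
      rw [integral_sub, integral_const_mul, integral_const_mul, h2, H.m2, dprod_succ]
      · ring
      all_goals
        apply hint
        fun_prop

/-- Weight. -/
def wg (g x : ℝ) : ℝ := 1 + g * (x^2/2 - 1)

lemma wg_dd (μ : Measure ℝ) [IsProbabilityMeasure μ] (hsupp : μ (Icc (-2) 2)ᶜ = 0)
    (v : ℕ → ℝ) (H : MomHyp μ v) (g : ℝ) (n : ℕ) :
    ∫ x, wg g x * DD v n x ∂μ = dprod v n * (1 - g * (v n * v (n+1))) := by
  have hint : ∀ q : ℝ → ℝ, Continuous q → Integrable q μ := fun q hq =>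
    integrable_of_cont μ hsupp q hq.continuousOn
  have hc := DD_cont v n
  obtain ⟨h1, h2⟩ := dd_moments μ hsupp v H n
  have : ∀ x, wg g x * DD v n x = (1 - g) * DD v n x + (g/2) * (x^2 * DD v n x) := by
    intro x; simp only [wg]; ring
  simp_rw [this]
  rw [integral_add, integral_const_mul, integral_const_mul, h1, h2]
  · ring
  all_goals
    apply hint
    fun_prop

/-! ### Part C: circle averages -/

lemma avg_of_diff (f : ℂ → ℂ) (hf : ∀ z : ℂ, ‖z‖ ≤ 1 → DifferentiableAt ℂ f z) :
    circleAverage f 0 1 = f 0 := by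
  apply circleAverage_of_differentiable_on_off_countable (s := ∅) Set.countable_empty
  · intro z hz
    have : ‖z‖ ≤ 1 := by simpa using hz
    exact (hf z this).continuousAt.continuousWithinAt
  · intro z hz
    have : ‖z‖ < 1 := by simpa using hz.1
    exact hf z this.le

lemma sphere_norm {z : ℂ} (hz : z ∈ Metric.sphere (0:ℂ) |1|) : ‖z‖ = 1 := by simpa using hz

lemma sphere_conj {z : ℂ} (hz : z ∈ Metric.sphere (0:ℂ) |1|) : z * conj z = 1 := by
  rw [Complex.mul_conj, Complex.normSq_eq_norm_sq, sphere_norm hz]; simp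

lemma circInt {E : Type*} [NormedAddCommGroup E] [NormedSpace ℝ E] (f : ℂ → E)
    (hf : ∀ z : ℂ, ‖z‖ = 1 → ContinuousAt f z) : CircleIntegrable f 0 1 := by
  apply ContinuousOn.circleIntegrable'
  intro z hz
  exact (hf z (sphere_norm hz)).continuousWithinAt

lemma avg_re (F : ℂ → ℂ) (f : ℂ → ℝ) (hF : ∀ z : ℂ, ‖z‖ = 1 → ContinuousAt F z)
    (h : ∀ z : ℂ, ‖z‖ = 1 → f z = (F z).re) : circleAverage f 0 1 = (circleAverage F 0 1).re := by
  have h1 := Complex.reCLM.circleAverage_comp_comm (circInt F hF)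
  rw [Complex.reCLM_apply] at h1
  rw [← h1]
  apply circleAverage_congr_sphere
  intro z hz
  simpa using h z (sphere_norm hz)

/-- Main logarithmic integral. -/
lemma avg_log (q : ℂ → ℂ) (hq : ∀ z : ℂ, ‖z‖ ≤ 1 → DifferentiableAt ℂ q z)
    (hq1 : ∀ z : ℂ, ‖z‖ ≤ 1 → ‖q z‖ < 1) (g : ℝ) :
    circleAverage (fun z : ℂ => (1 + g * (z^2).re) * Real.log (‖1 - z^2 * q (z^2)‖^2)) 0 1
      = - g * (q 0).re := by
  set l : ℂ → ℂ := fun Z => Complex.log (1 - Z * q Z) with hl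
  have hlt : ∀ z : ℂ, ‖z‖ ≤ 1 → ‖z * q z‖ < 1 := by
    intro z hz
    rw [norm_mul]
    calc ‖z‖ * ‖q z‖ ≤ 1 * ‖q z‖ := by gcongr
      _ < 1 := by simpa using hq1 z hz
  have hld : ∀ z : ℂ, ‖z‖ ≤ 1 → DifferentiableAt ℂ l z := by
    intro z hz
    have := hq z hz
    apply DifferentiableAt.clog
    · fun_prop
    · left
      have h1 := Complex.re_le_norm (z * q z)
      have := hlt z hz
      simp only [Complex.sub_re, Complex.one_re]; linarith
  set m : ℂ → ℂ := dslope l 0 with hm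
  have hmd : ∀ z : ℂ, ‖z‖ ≤ 1 → DifferentiableAt ℂ m z := by
    intro z hz
    by_cases h0 : z = 0
    · subst h0
      have hb : Metric.ball (0:ℂ) 1 ∈ 𝓝 (0:ℂ) := Metric.ball_mem_nhds _ one_pos
      have : DifferentiableOn ℂ m (Metric.ball 0 1) := by
        rw [hm, Complex.differentiableOn_dslope hb]
        intro y hy
        have : ‖y‖ < 1 := by simpa using hy
        exact (hld y this.le).differentiableWithinAt
      exact this.differentiableAt hb
    · rw [hm, differentiableAt_dslope_of_ne h0]
      exact hld z hz
  have hl0 : l 0 = 0 := by simp [hl]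
  have hm0 : m 0 = - q 0 := by
    rw [hm, dslope_same]
    have h1 : HasDerivAt (fun Z : ℂ => 1 - Z * q Z) (-(1 * q 0 + 0 * deriv q 0)) 0 :=
      ((hasDerivAt_id (0:ℂ)).mul (hq 0 (by simp)).hasDerivAt).const_sub 1
    have h2 := h1.clog (by simp)
    rw [hl, h2.deriv]; simp
  have hmz : ∀ Z : ℂ, Z * m Z = l Z := by
    intro Z
    have := sub_smul_dslope l 0 Z
    simpa [hl0] using this
  have hsq : ∀ z : ℂ, ‖z‖ ≤ 1 → ‖z^2‖ ≤ 1 := by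
    intro z hz; rw [norm_pow]; exact pow_le_one₀ (norm_nonneg _) hz
  set G : ℂ → ℂ := fun z => 2 * l (z^2) + g * (z^2 * l (z^2)) + g * m (z^2) with hG
  have hGd : ∀ z : ℂ, ‖z‖ ≤ 1 → DifferentiableAt ℂ G z := by
    intro z hz
    have h1 : DifferentiableAt ℂ (fun z => l (z^2)) z :=
      DifferentiableAt.comp z (hld _ (hsq z hz)) (by fun_prop)
    have h2 : DifferentiableAt ℂ (fun z => m (z^2)) z :=
      DifferentiableAt.comp z (hmd _ (hsq z hz)) (by fun_prop)
    exact ((h1.const_mul 2).add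
      ((DifferentiableAt.mul (by fun_prop : DifferentiableAt ℂ (fun z : ℂ => z^2) z) h1).const_mul (g:ℂ))).add
      (h2.const_mul (g:ℂ))
  rw [avg_re G _ (fun z hz => (hGd z hz.le).continuousAt), avg_of_diff G hGd]
  · simp [hG, hl0, hm0]
  · intro z hz
    have hz1 : ‖z^2‖ = 1 := by rw [norm_pow, hz]; simp
    have hzc : z^2 * conj (z^2) = 1 := by
      rw [Complex.mul_conj, Complex.normSq_eq_norm_sq, hz1]; simp
    have h1 : m (z^2) = conj (z^2) * l (z^2) := by
      rw [← hmz, ← mul_assoc, mul_comm (conj (z^2)), hzc, one_mul]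
    have h2 : Real.log (‖1 - z^2 * q (z^2)‖^2) = 2 * (l (z^2)).re := by
      rw [hl, Complex.log_re, Real.log_pow]; simp
    rw [h2]
    simp only [hG, h1]
    generalize z^2 = Z
    generalize l Z = W
    simp
    ring

lemma sphere_x {z : ℂ} (hz : ‖z‖ = 1) : ((2 * z.re : ℝ) : ℂ) = z + conj z := by
  rw [Complex.add_conj]

lemma wg_circle (g : ℝ) {z : ℂ} (hz : ‖z‖ = 1) : wg g (2 * z.re) = 1 + g * (z^2).re := by
  have h : z.re^2 + z.im^2 = 1 := by
    have := Complex.normSq_eq_norm_sq z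
    rw [hz, Complex.normSq_apply] at this; linarith
  simp only [wg, sq, Complex.mul_re]
  linear_combination (g) * h

lemma conj1 {z : ℂ} (hz : ‖z‖ = 1) : z * conj z = 1 := by
  rw [Complex.mul_conj, Complex.normSq_eq_norm_sq, hz]; simp

lemma dd_norm (v : ℕ → ℝ) (h0 : v 0 = -1) (n : ℕ) {z : ℂ} (hz : ‖z‖ = 1) :
    DD v n (2 * z.re) = ‖phs v n (z^2)‖^2 := by
  have := DD_circle v h0 z (conj1 hz) (2 * z.re) (sphere_x hz) n
  rw [Complex.mul_conj, Complex.normSq_eq_norm_sq] at this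
  exact_mod_cast this

lemma dd_pos_circle (v : ℕ → ℝ) (h0 : v 0 = -1) (hv : ∀ n, |v (n+1)| < 1) (n : ℕ) {z : ℂ} (hz : ‖z‖ = 1) :
    0 < DD v n (2 * z.re) := by
  rw [dd_norm v h0 n hz]
  have : phs v n (z^2) ≠ 0 := (phs_bound v hv (z^2) (by rw [norm_pow, hz]; simp) n).2
  positivity

lemma dd_pos (v : ℕ → ℝ) (h0 : v 0 = -1) (hv : ∀ n, |v (n+1)| < 1) (n : ℕ) (x : ℝ)
    (hx : x ∈ Icc (-2:ℝ) 2) : 0 < DD v n x := by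
  have h1 : (x/2)^2 ≤ 1 := by
    rw [sq_le_one_iff_abs_le_one, abs_le]; constructor <;> linarith [hx.1, hx.2]
  set z : ℂ := ⟨x/2, Real.sqrt (1 - (x/2)^2)⟩ with hz
  have hn : ‖z‖ = 1 := by
    have h2 : ‖z‖^2 = 1 := by
      rw [← Complex.normSq_eq_norm_sq, Complex.normSq_apply]
      simp only [hz]
      rw [Real.mul_self_sqrt (by linarith)]; ring
    have := norm_nonneg z
    nlinarith
  have := dd_pos_circle v h0 hv n hn
  have h3 : 2 * z.re = x := by simp only [hz]; ring
  rwa [h3] at this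

lemma avg_log_dd (v : ℕ → ℝ) (h0 : v 0 = -1) (hv : ∀ n, |v (n+1)| < 1) (g : ℝ) (n : ℕ) :
    circleAverage (fun z : ℂ => wg g (2 * z.re) * Real.log (DD v n (2 * z.re))) 0 1
      = g * ∑ k ∈ Finset.range n, v k * v (k+1) := by
  induction n with
  | zero => simp [DD, circleAverage_const]
  | succ n ih =>
    set q : ℂ → ℂ := fun Z => v (n+1) * (phi v n Z / phs v n Z) with hq
    have hqd : ∀ z : ℂ, ‖z‖ ≤ 1 → DifferentiableAt ℂ q z := by
      intro z hz
      have h1 := (phi_diff v n).1 z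
      have h2 := (phi_diff v n).2 z
      have h3 := (phs_bound v hv z hz n).2
      simp only [hq]
      fun_prop (disch := assumption)
    have hq1 : ∀ z : ℂ, ‖z‖ ≤ 1 → ‖q z‖ < 1 := by
      intro z hz
      obtain ⟨h1, h2⟩ := phs_bound v hv z hz n
      have h3 : 0 < ‖phs v n z‖ := norm_pos_iff.mpr h2
      simp only [hq, norm_mul, norm_div, Complex.norm_real, Real.norm_eq_abs]
      have : ‖phi v n z‖ / ‖phs v n z‖ ≤ 1 := (div_le_one h3).mpr h1
      calc |v (n+1)| * (‖phi v n z‖ / ‖phs v n z‖) ≤ |v (n+1)| * 1 := by gcongr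
        _ < 1 := by simpa using hv n
    have key := avg_log q hqd hq1 g
    have hq0 : q 0 = -(v n * v (n+1) : ℝ) := by
      simp only [hq, (phi_at_zero v h0 n).1, (phi_at_zero v h0 n).2]; push_cast; ring
    rw [hq0] at key
    have hsp : ∀ z : ℂ, ‖z‖ = 1 → Real.log (DD v (n+1) (2 * z.re)) =
        Real.log (DD v n (2 * z.re)) + Real.log (‖1 - z^2 * q (z^2)‖^2) := by
      intro z hz
      have hz2 : ‖z^2‖ = 1 := by rw [norm_pow, hz]; simp
      have h3 := (phs_bound v hv (z^2) hz2.le n).2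
      have e : phs v (n+1) (z^2) = phs v n (z^2) * (1 - z^2 * q (z^2)) := by
        rw [phs_succ]; simp only [hq]; field_simp
      have h4 := (phs_bound v hv (z^2) hz2.le (n+1)).2
      rw [e] at h4
      have h5 := right_ne_zero_of_mul h4
      rw [dd_norm v h0 _ hz, dd_norm v h0 _ hz, e, norm_mul, mul_pow, Real.log_mul]
      · positivity
      · positivity
    have hcc : ∀ z : ℂ, ‖z‖ = 1 → ContinuousAt (fun z : ℂ => wg g (2 * z.re) * Real.log (DD v n (2 * z.re))) z := by
      intro z hz
      have h1 := (dd_pos_circle v h0 hv n hz).ne'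
      have h2 : Continuous fun z : ℂ => DD v n (2 * z.re) := (DD_cont v n).comp (by fun_prop)
      have h3 := h2.continuousAt (x := z)
      have h4 := h3.log h1
      have h5 : Continuous fun z : ℂ => wg g (2 * z.re) := by unfold wg; fun_prop
      exact h5.continuousAt.mul h4
    have hcc2 : ∀ z : ℂ, ‖z‖ = 1 → ContinuousAt (fun z : ℂ => (1 + g * (z^2).re) * Real.log (‖1 - z^2 * q (z^2)‖^2)) z := by
      intro z hz
      have hz2 : ‖z^2‖ = 1 := by rw [norm_pow, hz]; simp
      have h1 : ContinuousAt (fun z : ℂ => q (z^2)) z :=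
        ContinuousAt.comp' (hqd _ hz2.le).continuousAt (by fun_prop)
      have h2 : ContinuousAt (fun z : ℂ => ‖1 - z^2 * q (z^2)‖^2) z :=
        ((continuousAt_const.sub
          (ContinuousAt.mul (by fun_prop : ContinuousAt (fun z : ℂ => z^2) z) h1)).norm.pow 2)
      have h3 : ‖1 - z^2 * q (z^2)‖^2 ≠ 0 := by
        have h4 : 1 - z^2 * q (z^2) ≠ 0 := by
          intro h
          have h5 : z^2 * q (z^2) = 1 := (sub_eq_zero.mp h).symm
          have h6 : ‖z^2 * q (z^2)‖ = 1 := by rw [h5]; simp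
          rw [norm_mul, hz2, one_mul] at h6
          linarith [hq1 (z^2) hz2.le]
        positivity
      have h4 := h2.log h3
      exact ContinuousAt.mul (by fun_prop) h4
    rw [Finset.sum_range_succ, mul_add, ← ih]
    have : -g * (-(v n * v (n+1) : ℝ) : ℂ).re = g * (v n * v (n+1)) := by
      simp only [Complex.neg_re, Complex.ofReal_re]; ring
    rw [← this, ← key, ← circleAverage_fun_add (circInt _ hcc) (circInt _ hcc2)]
    apply circleAverage_congr_sphere
    intro z hz
    have hz' := sphere_norm hz
    simp only
    rw [hsp z hz', mul_add, wg_circle g hz']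

/-! ### Part D: moment matching -/

def Jav (v : ℕ → ℝ) (n : ℕ) (f : ℂ → ℂ) : ℂ :=
  circleAverage (fun z => f z / (phs v n (z^2) * conj (phs v n (z^2)))) 0 1

lemma Jcont (v : ℕ → ℝ) (hv : ∀ n, |v (n+1)| < 1) (n : ℕ) (f : ℂ → ℂ) (hf : Continuous f)
    (z : ℂ) (hz : ‖z‖ = 1) :
    ContinuousAt (fun z => f z / (phs v n (z^2) * conj (phs v n (z^2)))) z := by
  have hne : phs v n (z^2) ≠ 0 := (phs_bound v hv (z^2) (by rw [norm_pow, hz]; simp) n).2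
  have hc : Continuous fun z : ℂ => phs v n (z^2) := (phi_diff v n).2.continuous.comp (by fun_prop)
  have hc2 : Continuous fun z : ℂ => conj (phs v n (z^2)) := Complex.continuous_conj.comp hc
  exact hf.continuousAt.div (hc.mul hc2).continuousAt (mul_ne_zero hne (by simpa using hne))

lemma Jlin (v : ℕ → ℝ) (hv : ∀ n, |v (n+1)| < 1) (n : ℕ) (f g h : ℂ → ℂ) (hf : Continuous f)
    (hg : Continuous g) (a b : ℂ)
    (e : ∀ z : ℂ, ‖z‖ = 1 → a * h z = f z + b * g z) :
    a * Jav v n h = Jav v n f + b * Jav v n g := by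
  unfold Jav
  rw [← smul_eq_mul a, ← smul_eq_mul b, ← circleAverage_fun_smul, ← circleAverage_fun_smul,
    ← circleAverage_fun_add]
  · apply circleAverage_congr_sphere
    intro z hz
    simp only [smul_eq_mul]
    rw [← mul_div_assoc, e z (sphere_norm hz)]
    ring
  · exact circInt _ (Jcont v hv n f hf)
  · apply circInt
    intro z hz
    exact (Jcont v hv n g hg z hz).const_smul b

def JA (v : ℕ → ℝ) (i k : ℕ) (z : ℂ) : ℂ := (conj z)^i * (z^2 * phi v k (z^2))
def JB (v : ℕ → ℝ) (i k : ℕ) (z : ℂ) : ℂ := (conj z)^i * phs v k (z^2)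

lemma JAc (v : ℕ → ℝ) (i k : ℕ) : Continuous (JA v i k) := by
  have hc : Continuous fun z : ℂ => phi v k (z^2) := (phi_diff v k).1.continuous.comp (by fun_prop)
  unfold JA
  exact (Complex.continuous_conj.pow i).mul ((continuous_id.pow 2).mul hc)
lemma JBc (v : ℕ → ℝ) (i k : ℕ) : Continuous (JB v i k) := by
  have hc : Continuous fun z : ℂ => phs v k (z^2) := (phi_diff v k).2.continuous.comp (by fun_prop)
  unfold JB
  exact (Complex.continuous_conj.pow i).mul hc

lemma avg_pow (v : ℕ → ℝ) (h0 : v 0 = -1) (hv : ∀ n, |v (n+1)| < 1) (n m : ℕ) :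
    (∀ z : ℂ, ‖z‖ ≤ 1 → DifferentiableAt ℂ (fun z => z^m / phs v n (z^2)) z) ∧
    circleAverage (fun z => z^m / phs v n (z^2)) 0 1 = 0^m := by
  have hd : ∀ z : ℂ, ‖z‖ ≤ 1 → DifferentiableAt ℂ (fun z => z^m / phs v n (z^2)) z := by
    intro z hz
    have hne : phs v n (z^2) ≠ 0 := (phs_bound v hv (z^2)
      (by rw [norm_pow]; exact pow_le_one₀ (norm_nonneg _) hz) n).2
    have hc : Differentiable ℂ fun z : ℂ => phs v n (z^2) := (phi_diff v n).2.comp (by fun_prop)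
    exact DifferentiableAt.div (by fun_prop) (hc z) hne
  refine ⟨hd, ?_⟩
  rw [avg_of_diff _ hd]
  simp [(phi_at_zero v h0 n).2]

lemma J_base (v : ℕ → ℝ) (h0 : v 0 = -1) (hv : ∀ n, |v (n+1)| < 1) (n i : ℕ) (hi : i ≤ 2*n+2) :
    Jav v n (JA v i n) = 0^(2*n+2-i) ∧ Jav v n (JB v i n) = 0^i := by
  constructor
  · rw [← (avg_pow v h0 hv n _).2]
    apply circleAverage_congr_sphere
    intro z hz
    have hz1 := sphere_norm hz
    have hz2 : ‖z^2‖ = 1 := by rw [norm_pow, hz1]; simp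
    have hne : phs v n (z^2) ≠ 0 := (phs_bound v hv (z^2) hz2.le n).2
    have hne2 : conj (phs v n (z^2)) ≠ 0 := by simpa using hne
    have h1 : (conj z)^i * z^(2*n+2) = z^(2*n+2-i) := by
      have : z^(2*n+2) = z^i * z^(2*n+2-i) := by rw [← pow_add]; congr 1; omega
      rw [this, ← mul_assoc, ← mul_pow, mul_comm (conj z), conj1 hz1, one_pow, one_mul]
    simp only [JA]
    rw [← h1, (phs_circle v (z^2) (conj1 hz2) n).2]
    field_simp
    try ring
  · have h1 := Complex.conjCLE.toContinuousLinearMap.circleAverage_comp_comm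
      (circInt _ fun z hz => ((avg_pow v h0 hv n i).1 z (le_of_eq hz)).continuousAt)
    rw [(avg_pow v h0 hv n i).2] at h1
    have h2 : Complex.conjCLE.toContinuousLinearMap (0^i : ℂ) = 0^i := by simp
    rw [h2] at h1
    rw [← h1]
    apply circleAverage_congr_sphere
    intro z hz
    have hz1 := sphere_norm hz
    have hz2 : ‖z^2‖ = 1 := by rw [norm_pow, hz1]; simp
    have hne : phs v n (z^2) ≠ 0 := (phs_bound v hv (z^2) hz2.le n).2
    have hne2 : conj (phs v n (z^2)) ≠ 0 := by simpa using hne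
    simp only [JB, Function.comp, ContinuousLinearEquiv.coe_coe, Complex.conjCLE_apply, map_div₀, map_pow]
    field_simp

lemma J_step (v : ℕ → ℝ) (hv : ∀ n, |v (n+1)| < 1) (n i k : ℕ) :
    ((1 - v (k+1)^2 : ℝ) : ℂ) * Jav v n (JA v i k) = Jav v n (JA v (i+2) (k+1)) + v (k+1) * Jav v n (JB v i (k+1)) ∧
    ((1 - v (k+1)^2 : ℝ) : ℂ) * Jav v n (JB v i k) = Jav v n (JB v i (k+1)) + v (k+1) * Jav v n (JA v (i+2) (k+1)) := by
  have hz : ∀ z : ℂ, ‖z‖ = 1 → JA v (i+2) (k+1) z = (conj z)^i * phi v (k+1) (z^2) := by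
    intro z hz
    have : (conj z)^2 * z^2 = 1 := by rw [← mul_pow, mul_comm, conj1 hz, one_pow]
    simp only [JA]
    linear_combination ((conj z)^i * phi v (k+1) (z^2)) * this
  constructor
  · apply Jlin v hv n _ _ _ (JAc _ _ _) (JBc _ _ _)
    intro z h
    rw [hz z h]
    simp only [JA, JB, phi_succ, phs_succ]; push_cast; ring
  · apply Jlin v hv n _ _ _ (JBc _ _ _) (JAc _ _ _)
    intro z h
    rw [hz z h]
    simp only [JB, phi_succ, phs_succ]; push_cast; ring

lemma J_main (v : ℕ → ℝ) (h0 : v 0 = -1) (hv : ∀ n, |v (n+1)| < 1) (n j : ℕ) :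
    ∀ k, k + j = n → (∀ i, 0 < i → i < 2*k+2 → Jav v n (JA v i k) = 0 ∧ Jav v n (JB v i k) = 0) ∧
      Jav v n (JA v (2*k+2) k) * dprod v n = dprod v k := by
  induction j with
  | zero =>
    intro k hk
    obtain rfl : k = n := by omega
    constructor
    · intro i hi hi2
      obtain ⟨h1, h2⟩ := J_base v h0 hv k i hi2.le
      rw [h1, h2, zero_pow (by omega), zero_pow (by omega)]; simp
    · rw [(J_base v h0 hv k _ le_rfl).1]; simp
  | succ j ih =>
    intro k hk
    obtain ⟨h1, h2⟩ := ih (k+1) (by omega)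
    have hne : ((1 - v (k+1)^2 : ℝ) : ℂ) ≠ 0 := by
      have := (sq_lt_one_iff_abs_lt_one (v (k+1))).mpr (hv k)
      exact_mod_cast (by linarith : (1 - v (k+1)^2 : ℝ) ≠ 0)
    constructor
    · intro i hi hi2
      obtain ⟨s1, s2⟩ := J_step v hv n i k
      rw [(h1 (i+2) (by omega) (by omega)).1, (h1 i hi (by omega)).2] at s1 s2
      constructor
      · exact (mul_eq_zero.mp (s1.trans (by simp))).resolve_left hne
      · exact (mul_eq_zero.mp (s2.trans (by simp))).resolve_left hne
    · obtain ⟨s1, s2⟩ := J_step v hv n (2*k+2) k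
      rw [(h1 (2*k+2) (by omega) (by omega)).2] at s1
      rw [dprod_succ] at h2
      apply mul_left_cancel₀ hne
      rw [← mul_assoc, s1]
      rw [show 2*k+2+2 = 2*(k+1)+2 by ring]
      push_cast at h2 ⊢
      linear_combination h2

lemma avg_poly (v : ℕ → ℝ) (h0 : v 0 = -1) (hv : ∀ n, |v (n+1)| < 1) (n : ℕ) :
    circleAverage (fun z : ℂ => 1 / DD v n (2 * z.re)) 0 1 = 1 / dprod v n ∧
    ∀ k ≤ n, circleAverage (fun z : ℂ => (PP v (k+1)).eval (2 * z.re) / DD v n (2 * z.re)) 0 1 = 0 := by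
  have hd := dprod_pos v hv n
  constructor
  · have hm := (J_main v h0 hv n n 0 (by omega)).2
    rw [avg_re (fun z => JA v (2*0+2) 0 z / (phs v n (z^2) * conj (phs v n (z^2)))) _
      (Jcont v hv n _ (JAc _ _ _))]
    · have : Jav v n (JA v (2*0+2) 0) = ((1 / dprod v n : ℝ) : ℂ) := by
        have hdc : (dprod v n : ℂ) ≠ 0 := by exact_mod_cast hd.ne'
        push_cast
        rw [eq_div_iff hdc, hm]; simp [dprod]
      change (Jav v n (JA v (2*0+2) 0)).re = _
      rw [this, Complex.ofReal_re]
    · intro z hz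
      have e1 : JA v (2*0+2) 0 z = 1 := by
        simp only [JA, phi_zero, mul_zero, zero_add, mul_one]
        rw [← mul_pow, mul_comm, conj1 hz, one_pow]
      rw [e1, ← DD_circle v h0 z (conj1 hz) (2 * z.re) (sphere_x hz) n]
      rw [← Complex.ofReal_one, ← Complex.ofReal_div, Complex.ofReal_re]
  · intro k hk
    obtain ⟨a1, a2⟩ := (J_main v h0 hv n (n-k) k (by omega)).1 (k+1) (by omega) (by omega)
    have hl := Jlin v hv n (JA v (k+1) k) (JB v (k+1) k)
      (fun z => JA v (k+1) k z + JB v (k+1) k z) (JAc _ _ _) (JBc _ _ _) 1 1 (by intro z hz; ring)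
    rw [a1, a2] at hl
    rw [avg_re (fun z => (JA v (k+1) k z + JB v (k+1) k z) / (phs v n (z^2) * conj (phs v n (z^2)))) _
      (Jcont v hv n _ ((JAc _ _ _).add (JBc _ _ _)))]
    · change (Jav v n (fun z => JA v (k+1) k z + JB v (k+1) k z)).re = 0
      have : Jav v n (fun z => JA v (k+1) k z + JB v (k+1) k z) = 0 := by simpa using hl
      rw [this]; simp
    · intro z hz
      have e1 : JA v (k+1) k z + JB v (k+1) k z = (((PP v (k+1)).eval (2 * z.re) : ℝ) : ℂ) := by
        have := (PP_circle v h0 z (conj z) (2 * z.re) (conj1 hz) (sphere_x hz) k).2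
        simp only [JA, JB]
        rw [← mul_add, ← this, mul_comm, mul_assoc, ← mul_pow, conj1 hz, one_pow, mul_one]
      rw [e1, ← DD_circle v h0 z (conj1 hz) (2 * z.re) (sphere_x hz) n]
      rw [← Complex.ofReal_div, Complex.ofReal_re]

lemma poly_match (μ : Measure ℝ) [IsProbabilityMeasure μ] (hsupp : μ (Icc (-2) 2)ᶜ = 0)
    (v : ℕ → ℝ) (H : MomHyp μ v) (n m : ℕ) (hm : m ≤ n + 1) :
    ∀ p : ℝ[X], p.natDegree ≤ m →
    circleAverage (fun z : ℂ => p.eval (2 * z.re) / DD v n (2 * z.re)) 0 1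
      = (∫ x, p.eval x ∂μ) / dprod v n := by
  have hc : ∀ (p : ℝ[X]) (z : ℂ), ‖z‖ = 1 →
      ContinuousAt (fun z : ℂ => p.eval (2 * z.re) / DD v n (2 * z.re)) z := by
    intro p z hz
    have h2 : Continuous fun z : ℂ => DD v n (2 * z.re) := (DD_cont v n).comp (by fun_prop)
    have h1 : Continuous fun z : ℂ => p.eval (2 * z.re) := p.continuous.comp (by fun_prop)
    exact h1.continuousAt.div h2.continuousAt (dd_pos_circle v H.v0 H.vlt n hz).ne'
  have hint : ∀ p : ℝ[X], Integrable (fun x => p.eval x) μ := fun p =>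
    integrable_of_cont μ hsupp _ p.continuous.continuousOn
  have hlin : ∀ (p q : ℝ[X]) (a : ℝ),
      circleAverage (fun z : ℂ => p.eval (2 * z.re) / DD v n (2 * z.re)) 0 1
        = (∫ x, p.eval x ∂μ) / dprod v n →
      circleAverage (fun z : ℂ => q.eval (2 * z.re) / DD v n (2 * z.re)) 0 1
        = (∫ x, q.eval x ∂μ) / dprod v n →
      circleAverage (fun z : ℂ => (p + C a * q).eval (2 * z.re) / DD v n (2 * z.re)) 0 1
        = (∫ x, (p + C a * q).eval x ∂μ) / dprod v n := by
    intro p q a hp hq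
    have e1 : (∫ x, (p + C a * q).eval x ∂μ) = (∫ x, p.eval x ∂μ) + a * ∫ x, q.eval x ∂μ := by
      rw [← integral_const_mul, ← integral_add (hint p) ((hint q).const_mul a)]
      simp
    rw [e1, add_div, mul_div_assoc, ← hp, ← hq, ← smul_eq_mul a, ← circleAverage_fun_smul,
      ← circleAverage_fun_add]
    · congr 1; ext z; simp only [eval_add, eval_mul, eval_C, smul_eq_mul]; ring
    · exact circInt _ (hc p)
    · exact circInt _ fun z hz => (hc q z hz).const_smul a
  have hone : circleAverage (fun z : ℂ => (1:ℝ[X]).eval (2 * z.re) / DD v n (2 * z.re)) 0 1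
        = (∫ x, (1:ℝ[X]).eval x ∂μ) / dprod v n := by
    have := (avg_poly v H.v0 H.vlt n).1
    simpa using this
  have hPP : ∀ k ≤ n + 1, circleAverage (fun z : ℂ => (PP v k).eval (2 * z.re) / DD v n (2 * z.re)) 0 1
        = (∫ x, (PP v k).eval x ∂μ) / dprod v n := by
    intro k hk
    rcases k with _ | k
    · rw [PP_zero]; exact hone
    · rw [(avg_poly v H.v0 H.vlt n).2 k (by omega), H.m0 k]; simp
  have hzero : circleAverage (fun z : ℂ => (0:ℝ[X]).eval (2 * z.re) / DD v n (2 * z.re)) 0 1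
        = (∫ x, (0:ℝ[X]).eval x ∂μ) / dprod v n := by
    simp [circleAverage_const]
  induction m with
  | zero =>
    intro p hp
    have e : p = 0 + C (p.coeff 0) * 1 := by
      rw [zero_add, mul_one]; exact eq_C_of_natDegree_le_zero hp
    rw [e]
    exact hlin _ _ _ hzero hone
  | succ m ih =>
    intro p hp
    set q := p - C (p.coeff (m+1)) * PP v (m+1) with hq
    have hqd : q.natDegree ≤ m := by
      have hP := (PP_degree v m).2
      have hPn : (PP v (m+1)).natDegree = m + 1 := natDegree_eq_of_degree_eq_some hP.2
      rw [natDegree_le_iff_coeff_eq_zero]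
      intro N hN
      rcases Nat.lt_or_ge (m+1) N with h | h
      · rw [hq, coeff_sub, coeff_C_mul, coeff_eq_zero_of_natDegree_lt (by omega),
          coeff_eq_zero_of_natDegree_lt (p := PP v (m+1)) (by omega)]; simp
      · obtain rfl : N = m + 1 := by omega
        have : (PP v (m+1)).coeff (m+1) = 1 := by
          have := hP.1.coeff_natDegree; rwa [hPn] at this
        rw [hq, coeff_sub, coeff_C_mul, this]; simp
    have e : p = q + C (p.coeff (m+1)) * PP v (m+1) := by rw [hq]; ring
    rw [e]
    exact hlin _ _ _ (ih (by omega) q hqd) (hPP _ hm)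

/-! ### Part E: the constant -/

lemma avg_wg (g : ℝ) : circleAverage (fun z : ℂ => 1 + g * (z^2).re) 0 1 = 1 := by
  rw [avg_re (fun z => 1 + g * z^2) _ (by intro z _; fun_prop), avg_of_diff _ (by intro z _; fun_prop)]
  · simp
  · intro z _; simp [Complex.mul_re]

lemma avg_wlogw_aux (g : ℝ) (h1 : -1 < g) (h2 : g < 0) :
    circleAverage (fun z : ℂ => (1 + g * (z^2).re) * Real.log (1 + g * (z^2).re)) 0 1 = Hgw g := by
  have hg2 : g^2 < 1 := by nlinarith
  set s := Real.sqrt (1 - g^2) with hs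
  have hs0 : 0 ≤ s := Real.sqrt_nonneg _
  have hss : s^2 = 1 - g^2 := Real.sq_sqrt (by linarith)
  set β : ℝ := -g/(1+s) with hβ
  have hβ0 : 0 ≤ β := by rw [hβ]; apply div_nonneg <;> linarith
  have hβ1 : β < 1 := by rw [hβ, div_lt_one (by linarith)]; linarith
  have hbs : β * (1+s) = -g := by rw [hβ]; field_simp
  have hw : ∀ z : ℂ, ‖z‖ = 1 → 1 + g * (z^2).re = (1+s)/2 * ‖1 - z^2 * (β:ℂ)‖^2 := by
    intro z hz
    have hz2 : ‖z^2‖ = 1 := by rw [norm_pow, hz]; simp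
    have h3 := Complex.normSq_eq_norm_sq (z^2)
    rw [hz2, Complex.normSq_apply] at h3
    rw [← Complex.normSq_eq_norm_sq, Complex.normSq_apply]
    generalize z^2 = Z at *
    simp only [Complex.sub_re, Complex.sub_im, Complex.one_re, Complex.one_im, Complex.mul_re,
      Complex.mul_im, Complex.ofReal_re, Complex.ofReal_im]
    have h4 : (1+s) * (1 + β^2) = 2 := by
      have h5 : (1+s) * ((1+s) * (1 + β^2)) = (1+s) * 2 := by
        linear_combination (β * (1+s) - g) * hbs + hss
      exact mul_left_cancel₀ (by linarith) h5
    linear_combination (-(1+s)/2 * β^2) * h3 - h4/2 + Z.re * hbs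
  have hne : ∀ z : ℂ, ‖z‖ = 1 → ‖1 - z^2 * (β:ℂ)‖^2 ≠ 0 := by
    intro z hz h
    have h3 := hw z hz
    rw [h] at h3
    have hz2 : ‖z^2‖ = 1 := by rw [norm_pow, hz]; simp
    have := Complex.abs_re_le_norm (z^2)
    rw [hz2, abs_le] at this
    nlinarith
  have key := avg_log (fun _ => (β:ℂ)) (by intro z _; fun_prop)
    (by intro z _; simpa [abs_of_nonneg hβ0] using hβ1) g
  have hH : Hgw g = Real.log ((1+s)/2) * circleAverage (fun z : ℂ => 1 + g * (z^2).re) 0 1 + -g * ((β:ℂ)).re := by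
    rw [avg_wg, Hgw, ← hs, Complex.ofReal_re]
    have : -g * β = 1 - s := by
      apply mul_right_cancel₀ (b := 1+s) (by linarith)
      linear_combination (-g) * hbs + hss
    rw [this]; ring
  rw [hH, ← key, ← smul_eq_mul (Real.log _), ← circleAverage_fun_smul, ← circleAverage_fun_add]
  · apply circleAverage_congr_sphere
    intro z hz
    have hz1 := sphere_norm hz
    simp only [smul_eq_mul]
    rw [← mul_comm (1 + g * (z^2).re), ← mul_add, ← Real.log_mul (by positivity) (hne z hz1), ← hw z hz1]
  · apply circInt; intro z hz; fun_prop
  · apply circInt; intro z hz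
    apply ContinuousAt.mul (by fun_prop)
    exact ContinuousAt.log (by fun_prop) (hne z hz)

lemma avg_wlogw (g : ℝ) (h1 : -1 ≤ g) (h2 : g ≤ 0) :
    circleAverage (fun z : ℂ => wg g (2 * z.re) * Real.log (wg g (2 * z.re))) 0 1 = Hgw g := by
  have e : circleAverage (fun z : ℂ => wg g (2 * z.re) * Real.log (wg g (2 * z.re))) 0 1 =
      circleAverage (fun z : ℂ => (1 + g * (z^2).re) * Real.log (1 + g * (z^2).re)) 0 1 := by
    apply circleAverage_congr_sphere
    intro z hz
    simp only
    rw [wg_circle g (sphere_norm hz)]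
  rw [e]
  have hE : EqOn (fun g : ℝ => circleAverage (fun z : ℂ => (1 + g * (z^2).re) * Real.log (1 + g * (z^2).re)) 0 1)
      Hgw (Ioo (-1) 0) := fun g hg => avg_wlogw_aux g hg.1 hg.2
  have hc1 : Continuous (fun g : ℝ => circleAverage (fun z : ℂ => (1 + g * (z^2).re) * Real.log (1 + g * (z^2).re)) 0 1) := by
    unfold circleAverage
    refine Continuous.const_smul (α := ℝ) (M := ℝ) ?_ _
    apply intervalIntegral.continuous_parametric_intervalIntegral_of_continuous'
    have : Continuous fun p : ℝ × ℝ => (1 + p.1 * ((circleMap 0 1 p.2)^2).re) := by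
      have := (continuous_circleMap 0 1).comp (continuous_snd (X := ℝ) (Y := ℝ))
      exact continuous_const.add (continuous_fst.mul (Complex.continuous_re.comp (this.pow 2)))
    exact Real.continuous_mul_log.comp this
  have hc2 : Continuous Hgw := by
    unfold Hgw
    apply Continuous.add (by fun_prop)
    apply Continuous.log (by fun_prop)
    intro x
    have := Real.sqrt_nonneg (1 - x^2)
    positivity
  have := hE.closure hc1 hc2
  rw [closure_Ioo (by norm_num)] at this
  exact this ⟨h1, h2⟩

/-! ### Part F: the measure rho -/

def rden (g x : ℝ) : ℝ≥0∞ := ENNReal.ofReal (wg g x / (π * Real.sqrt (4 - x^2)))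

lemma wg_nonneg (g : ℝ) (h1 : -1 ≤ g) (h2 : g ≤ 0) (x : ℝ) (hx : x ∈ Icc (-2:ℝ) 2) : 0 ≤ wg g x := by
  have : x^2 ≤ 4 := by nlinarith [hx.1, hx.2]
  unfold wg; nlinarith [sq_nonneg x]

lemma rden_meas (g : ℝ) : Measurable (rden g) := by unfold rden wg; fun_prop

lemma rhog_eq (g : ℝ) (h1 : -1 ≤ g) (h2 : g ≤ 0) :
    rhog g = (volume.restrict (Ioo (-2) 2)).withDensity (rden g) := by
  rw [← withDensity_indicator measurableSet_Ioo]
  unfold rhog SCm ArcsineM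
  rw [← withDensity_smul _ (by fun_prop), ← withDensity_smul _ (by fun_prop),
    ← withDensity_add_left (by fun_prop)]
  congr 1
  ext x
  simp only [Pi.add_apply, Pi.smul_apply, smul_eq_mul]
  by_cases hx : x ∈ Ioo (-2:ℝ) 2
  · rw [indicator_of_mem hx, rden]
    have hs : 0 < 4 - x^2 := by nlinarith [hx.1, hx.2]
    have hs1 : 0 < Real.sqrt (4 - x^2) := Real.sqrt_pos.mpr hs
    have hs2 : Real.sqrt (4 - x^2)^2 = 4 - x^2 := Real.sq_sqrt hs.le
    have hpi := Real.pi_pos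
    rw [abs_of_nonpos h2, ← ENNReal.ofReal_mul (by linarith), ← ENNReal.ofReal_mul (by linarith),
      ← ENNReal.ofReal_add]
    · congr 1
      unfold wg
      field_simp
      rw [hs2]; ring
    · apply mul_nonneg (by linarith); positivity
    · apply mul_nonneg (by linarith); positivity
  · rw [indicator_of_notMem hx]
    have hs : 4 - x^2 ≤ 0 := by
      by_contra h
      push Not at h
      apply hx
      constructor <;> nlinarith
    rw [Real.sqrt_eq_zero_of_nonpos hs]; simp

lemma image_cos : (fun φ : ℝ => 2 * Real.cos φ) '' Ioo 0 π = Ioo (-2) 2 := by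
  ext x
  constructor
  · rintro ⟨φ, ⟨h1, h2⟩, rfl⟩
    have a := Real.cos_lt_cos_of_nonneg_of_le_pi le_rfl h2.le h1
    have b := Real.cos_lt_cos_of_nonneg_of_le_pi h1.le le_rfl h2
    rw [Real.cos_zero] at a; rw [Real.cos_pi] at b
    constructor <;> simp only <;> linarith
  · rintro ⟨h1, h2⟩
    refine ⟨Real.arccos (x/2), ⟨?_, ?_⟩, ?_⟩
    · rw [Real.arccos_pos]; linarith
    · refine lt_of_le_of_ne (Real.arccos_le_pi _) ?_
      rw [Ne, Real.arccos_eq_pi]; linarith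
    · simp only
      rw [Real.cos_arccos (by linarith) (by linarith)]; ring

def cden (g φ : ℝ) : ℝ≥0∞ := ENNReal.ofReal (wg g (2 * Real.cos φ) / π)

lemma cden_meas (g : ℝ) : Measurable (cden g) := by unfold cden wg; fun_prop

lemma rhog_map (g : ℝ) (h1 : -1 ≤ g) (h2 : g ≤ 0) :
    rhog g = ((volume.restrict (Ioo 0 π)).withDensity (cden g)).map (fun φ : ℝ => 2 * Real.cos φ) := by
  have hcm : Measurable (fun φ : ℝ => 2 * Real.cos φ) := by fun_prop
  ext s hs
  rw [rhog_eq g h1 h2, Measure.map_apply hcm hs, withDensity_apply _ hs, withDensity_apply _ (hcm hs),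
    ← lintegral_indicator hs, ← lintegral_indicator (hcm hs), ← image_cos]
  rw [lintegral_image_eq_lintegral_abs_deriv_mul (f' := fun φ => -(2 * Real.sin φ)) measurableSet_Ioo]
  · apply setLIntegral_congr_fun measurableSet_Ioo
    intro φ hφ
    have hsin : 0 < Real.sin φ := Real.sin_pos_of_pos_of_lt_pi hφ.1 hφ.2
    simp only
    by_cases hm : 2 * Real.cos φ ∈ s
    · rw [indicator_of_mem hm, indicator_of_mem (by exact hm)]
      rw [rden, cden, ← ENNReal.ofReal_mul (abs_nonneg _), abs_neg, abs_of_pos (by linarith)]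
      congr 1
      have : Real.sqrt (4 - (2 * Real.cos φ)^2) = 2 * Real.sin φ := by
        rw [show 4 - (2 * Real.cos φ)^2 = (2 * Real.sin φ)^2 by
          have := Real.sin_sq_add_cos_sq φ; linear_combination (-4) * this]
        exact Real.sqrt_sq (by linarith)
      rw [this]
      have := Real.pi_pos
      field_simp
    · rw [indicator_of_notMem hm, indicator_of_notMem (by exact hm), mul_zero]
  · intro φ _
    have := ((Real.hasDerivAt_cos φ).const_mul 2).hasDerivWithinAt (s := Ioo 0 π)
    rw [mul_neg] at this
    exact this
  · intro a ha b hb h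
    have h' : Real.cos a = Real.cos b := by simpa using h
    exact Real.injOn_cos ⟨ha.1.le, ha.2.le⟩ ⟨hb.1.le, hb.2.le⟩ h'

lemma rho_int (g : ℝ) (h1 : -1 ≤ g) (h2 : g ≤ 0) (h : ℝ → ℝ) (hm : Measurable h)
    (hc : Continuous fun φ : ℝ => wg g (2 * Real.cos φ) * h (2 * Real.cos φ)) :
    Integrable h (rhog g) ∧
    ∫ x, h x ∂(rhog g) = circleAverage (fun z : ℂ => wg g (2 * z.re) * h (2 * z.re)) 0 1 := by
  have hcm : Measurable (fun φ : ℝ => 2 * Real.cos φ) := by fun_prop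
  have hpi := Real.pi_pos
  have hw : ∀ φ : ℝ, 0 ≤ wg g (2 * Real.cos φ) := fun φ =>
    wg_nonneg g h1 h2 _ ⟨by linarith [Real.neg_one_le_cos φ], by linarith [Real.cos_le_one φ]⟩
  have hden : ∀ φ, (cden g φ).toReal = wg g (2 * Real.cos φ) / π := fun φ => by
    rw [cden, ENNReal.toReal_ofReal]; exact div_nonneg (hw φ) hpi.le
  have hfin : ∀ᵐ φ ∂(volume.restrict (Ioo 0 π)), cden g φ < ⊤ := by
    filter_upwards with φ; exact ENNReal.ofReal_lt_top
  set k : ℝ → ℝ := fun φ : ℝ => wg g (2 * Real.cos φ) * h (2 * Real.cos φ) with hk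
  have hsm : ∀ φ, (cden g φ).toReal • h (2 * Real.cos φ) = π⁻¹ * k φ := by
    intro φ; rw [hden, smul_eq_mul, hk]; simp only; ring
  constructor
  · rw [rhog_map g h1 h2, integrable_map_measure hm.aestronglyMeasurable hcm.aemeasurable,
      integrable_withDensity_iff_integrable_smul' (cden_meas g) hfin]
    simp only [Function.comp, hsm]
    exact ((hc.const_mul π⁻¹).integrableOn_Icc (a := 0) (b := π)).mono_set Ioo_subset_Icc_self
  · rw [rhog_map g h1 h2, integral_map hcm.aemeasurable hm.aestronglyMeasurable,
      integral_withDensity_eq_integral_toReal_smul (cden_meas g) hfin]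
    simp only [hsm]
    rw [integral_const_mul, ← integral_Ioc_eq_integral_Ioo, ← intervalIntegral.integral_of_le hpi.le]
    unfold circleAverage
    have hre : ∀ θ : ℝ, (circleMap 0 1 θ).re = Real.cos θ := by
      intro θ; simp [circleMap, Complex.exp_ofReal_mul_I_re]
    simp only [hre]
    change _ = (2*π)⁻¹ • ∫ θ in 0..2*π, k θ
    have hs : ∫ θ in 0..2*π, k θ = (∫ θ in 0..π, k θ) + ∫ θ in π..2*π, k θ :=
      (intervalIntegral.integral_add_adjacent_intervals (hc.intervalIntegrable _ _) (hc.intervalIntegrable _ _)).symm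
    have hs2 : ∫ θ in π..2*π, k θ = ∫ θ in 0..π, k θ := by
      have := intervalIntegral.integral_comp_sub_left k (2*π) (a := 0) (b := π)
      rw [show 2*π - π = π by ring, sub_zero] at this
      rw [← this]
      congr 1
      ext θ
      simp [hk, Real.cos_two_pi_sub]
    rw [hs, hs2, smul_eq_mul]
    field_simp
    ring

lemma rho_prob (g : ℝ) (h1 : -1 ≤ g) (h2 : g ≤ 0) : IsProbabilityMeasure (rhog g) := by
  obtain ⟨a, b⟩ := rho_int g h1 h2 (fun _ => 1) measurable_const (by unfold wg; fun_prop)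
  have hf : IsFiniteMeasure (rhog g) := by
    rcases integrable_const_iff.mp a with h | h
    · norm_num at h
    · exact h
  have e : circleAverage (fun z : ℂ => wg g (2 * z.re) * 1) 0 1 = 1 := by
    refine Eq.trans ?_ (avg_wg g)
    apply circleAverage_congr_sphere
    intro z hz
    simp only
    rw [wg_circle g (sphere_norm hz), mul_one]
  rw [e] at b
  constructor
  simp only [integral_const, smul_eq_mul, mul_one] at b
  rw [measureReal_def] at b
  rw [← ENNReal.ofReal_toReal (measure_ne_top (rhog g) univ), b]; simp

lemma rho_ae (g : ℝ) (h1 : -1 ≤ g) (h2 : g ≤ 0) : ∀ᵐ x ∂(rhog g), x ∈ Ioo (-2:ℝ) 2 := by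
  rw [rhog_eq g h1 h2]
  exact (withDensity_absolutelyContinuous _ _).ae_le (ae_restrict_mem measurableSet_Ioo)

lemma rho_supp (g : ℝ) (h1 : -1 ≤ g) (h2 : g ≤ 0) : rhog g (Icc (-2) 2)ᶜ = 0 := by
  have : ∀ᵐ x ∂(rhog g), x ∈ Icc (-2:ℝ) 2 := (rho_ae g h1 h2).mono fun x hx => Ioo_subset_Icc_self hx
  exact this

lemma wg_pos (g : ℝ) (h1 : -1 ≤ g) (h2 : g ≤ 0) (x : ℝ) (hx : x ∈ Ioo (-2:ℝ) 2) : 0 < wg g x := by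
  have : x^2 < 4 := by nlinarith [hx.1, hx.2]
  unfold wg
  by_cases h : g = 0
  · subst h; norm_num
  · have : g < 0 := lt_of_le_of_ne h2 h
    nlinarith [sq_nonneg x]

/-! ### Part G: entropy lemmas -/

lemma KLdiv_eq (ν μ : Measure ℝ) [IsProbabilityMeasure ν] [IsProbabilityMeasure μ] :
    KLdiv ν μ = InformationTheory.klDiv ν μ := by
  rw [KLdiv, InformationTheory.klDiv_def]
  simp

lemma log_sub_le {x y : ℝ} (hx : 0 < x) (hy : 0 < y) : Real.log x - Real.log y ≤ (x - y)/y := by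
  have := Real.log_le_sub_one_of_pos (div_pos hx hy)
  rw [Real.log_div hx.ne' hy.ne'] at this
  rw [sub_div, div_self hy.ne']; exact this

lemma klFun_ge {r f : ℝ} (hr : 0 ≤ r) (hf : 0 ≤ f) (h : r ≠ 0 → 0 < f) :
    r * Real.log f + 1 - f ≤ InformationTheory.klFun r := by
  unfold InformationTheory.klFun
  by_cases h0 : r = 0
  · subst h0; simp; exact hf
  · have hr' : 0 < r := lt_of_le_of_ne hr (Ne.symm h0)
    have h1 := log_sub_le (h h0) hr'
    have h2 : r * (Real.log f - Real.log r) ≤ f - r := by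
      calc r * (Real.log f - Real.log r) ≤ r * ((f - r)/r) := by gcongr
        _ = f - r := by field_simp
    linarith

lemma KL_lower (ν μ : Measure ℝ) [IsProbabilityMeasure ν] [IsProbabilityMeasure μ] (f : ℝ → ℝ)
    (hν : ∀ᵐ x ∂ν, 0 < f x) (hμ : ∀ᵐ x ∂μ, 0 ≤ f x) (hfi : Integrable f μ) (hf1 : ∫ x, f x ∂μ = 1)
    (hl : Integrable (fun x => Real.log (f x)) ν) :
    ENNReal.ofReal (∫ x, Real.log (f x) ∂ν) ≤ KLdiv ν μ := by
  rw [KLdiv]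
  split_ifs with h
  · obtain ⟨hac, hint⟩ := h
    apply ENNReal.ofReal_le_ofReal
    have h1 := InformationTheory.integral_klFun_rnDeriv hac hint
    simp only [probReal_univ, add_sub_cancel_right] at h1
    rw [← h1]
    have hk := (InformationTheory.integrable_klFun_rnDeriv_iff hac).mpr hint
    have hr := (integrable_rnDeriv_smul_iff hac).mpr hl
    have hri := integral_rnDeriv_smul (f := fun x => Real.log (f x)) hac
    have hae : ∀ᵐ x ∂μ, ν.rnDeriv μ x ≠ 0 → 0 < f x := by
      rw [← ae_withDensity_iff (Measure.measurable_rnDeriv ν μ), Measure.withDensity_rnDeriv_eq _ _ hac]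
      exact hν
    have hle : ∫ x, ((ν.rnDeriv μ x).toReal • Real.log (f x) + 1 - f x) ∂μ ≤
        ∫ x, InformationTheory.klFun (ν.rnDeriv μ x).toReal ∂μ := by
      apply integral_mono_ae ((hr.add (integrable_const 1)).sub hfi) hk
      filter_upwards [hae, hμ] with x hx1 hx2
      apply klFun_ge ENNReal.toReal_nonneg hx2
      intro h; apply hx1; intro h'; rw [h'] at h; simp at h
    have e1 := integral_sub (hr.add (integrable_const (1:ℝ))) hfi
    rw [integral_add' hr (integrable_const (1:ℝ)), hri, hf1] at e1
    simp only [integral_const, probReal_univ, one_smul, add_sub_cancel_right] at e1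
    rw [← e1]
    exact hle
  · exact le_top

section upper
variable (ν μ : Measure ℝ) [IsProbabilityMeasure ν] [IsProbabilityMeasure μ]

lemma U1 (hν : ν (Icc (-2) 2)ᶜ = 0) (hμ : μ (Icc (-2) 2)ᶜ = 0) (C0 : ℝ)
    (hp : ∀ p : ℝ[X], (∀ x ∈ Icc (-2:ℝ) 2, 0 < p.eval x) →
      ∫ x, Real.log (p.eval x) ∂ν - ∫ x, p.eval x ∂μ + 1 ≤ C0)
    (f : ℝ → ℝ) (hf : Continuous f) (ε : ℝ) (hε : 0 < ε) (hfε : ∀ x, ε ≤ f x) :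
    ∫ x, Real.log (f x) ∂ν - ∫ x, f x ∂μ + 1 ≤ C0 := by
  have main : ∀ δ, 0 < δ → δ < ε/2 → ∫ x, Real.log (f x) ∂ν - ∫ x, f x ∂μ + 1 ≤ C0 + (2/ε + 1) * δ := by
    intro δ h0 h1
    obtain ⟨p, hpp⟩ := exists_polynomial_near_of_continuousOn (-2) 2 f hf.continuousOn δ h0
    have hpos : ∀ x ∈ Icc (-2:ℝ) 2, ε/2 < p.eval x := by
      intro x hx
      have := (abs_lt.mp (hpp x hx)).1
      linarith [hfε x]
    have hpos' : ∀ x ∈ Icc (-2:ℝ) 2, 0 < p.eval x := fun x hx => by linarith [hpos x hx]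
    have hk := hp p hpos'
    have i1 : Integrable (fun x => Real.log (p.eval x)) ν :=
      integrable_of_cont ν hν _ (p.continuous.continuousOn.log fun x hx => (hpos' x hx).ne')
    have i2 : Integrable (fun x => Real.log (f x)) ν :=
      integrable_of_cont ν hν _ (hf.continuousOn.log fun x hx => by linarith [hfε x])
    have i3 : Integrable (fun x => p.eval x) μ := integrable_of_cont μ hμ _ p.continuous.continuousOn
    have i4 : Integrable f μ := integrable_of_cont μ hμ _ hf.continuousOn
    have e1 : ∫ x, Real.log (f x) ∂ν ≤ ∫ x, (Real.log (p.eval x) + 2/ε * δ) ∂ν := by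
      apply integral_mono_ae i2 (i1.add (integrable_const _))
      have : ∀ᵐ x ∂ν, x ∈ Icc (-2:ℝ) 2 := hν
      filter_upwards [this] with x hx
      have a := log_sub_le (by linarith [hfε x] : 0 < f x) (hpos' x hx)
      have b : (f x - p.eval x)/p.eval x ≤ 2/ε * δ := by
        rw [div_le_iff₀ (hpos' x hx)]
        have := (abs_lt.mp (hpp x hx)).1
        have h3 : δ ≤ 2/ε * δ * p.eval x := by
          have : 2/ε * δ * (ε/2) ≤ 2/ε * δ * p.eval x := by
            have := (hpos x hx).le; gcongr
          calc δ = 2/ε * δ * (ε/2) := by field_simp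
            _ ≤ _ := this
        linarith
      simp only [Pi.add_apply]; linarith
    have e2 : ∫ x, p.eval x ∂μ ≤ ∫ x, (f x + δ) ∂μ := by
      apply integral_mono_ae i3 (i4.add (integrable_const _))
      have : ∀ᵐ x ∂μ, x ∈ Icc (-2:ℝ) 2 := hμ
      filter_upwards [this] with x hx
      have := (abs_lt.mp (hpp x hx)).2
      simp only [Pi.add_apply]; linarith
    rw [integral_add i1 (integrable_const _)] at e1
    rw [integral_add i4 (integrable_const _)] at e2
    simp at e1 e2
    linarith
  have hK : 0 < 2/ε + 1 := by positivity
  apply le_of_forall_pos_le_add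
  intro η hη
  have := main (min (ε/4) (η/(2/ε+1))) (by positivity) (by
    have := min_le_left (ε/4) (η/(2/ε+1)); linarith)
  refine this.trans ?_
  have h2 : (2/ε+1) * min (ε/4) (η/(2/ε+1)) ≤ (2/ε+1) * (η/(2/ε+1)) := by
    gcongr; exact min_le_right _ _
  rw [mul_div_cancel₀ _ hK.ne'] at h2
  linarith

lemma log_bdd {ε M y : ℝ} (hε : 0 < ε) (h1 : ε ≤ y) (h2 : y ≤ M) :
    ‖Real.log y‖ ≤ |Real.log ε| + |Real.log M| := by
  rw [Real.norm_eq_abs, abs_le]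
  have a := Real.log_le_log hε h1
  have b := Real.log_le_log (by linarith) h2
  have := neg_abs_le (Real.log ε)
  have := le_abs_self (Real.log M)
  have := abs_nonneg (Real.log ε)
  have := abs_nonneg (Real.log M)
  constructor <;> linarith

lemma U2 (hν : ν (Icc (-2) 2)ᶜ = 0) (hμ : μ (Icc (-2) 2)ᶜ = 0) (C0 : ℝ)
    (hp : ∀ p : ℝ[X], (∀ x ∈ Icc (-2:ℝ) 2, 0 < p.eval x) →
      ∫ x, Real.log (p.eval x) ∂ν - ∫ x, p.eval x ∂μ + 1 ≤ C0)
    (f : ℝ → ℝ) (hf : Measurable f) (ε M : ℝ) (hε : 0 < ε) (hfε : ∀ x, ε ≤ f x) (hfM : ∀ x, f x ≤ M) :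
    ∫ x, Real.log (f x) ∂ν - ∫ x, f x ∂μ + 1 ≤ C0 := by
  have hfb : ∀ x, ‖f x‖ ≤ M := fun x => by
    rw [Real.norm_eq_abs, abs_of_pos (by linarith [hfε x])]; exact hfM x
  have if1 : Integrable f (ν + μ) := Integrable.of_bound hf.aestronglyMeasurable M (ae_of_all _ hfb)
  have if2 : Integrable f ν := Integrable.of_bound hf.aestronglyMeasurable M (ae_of_all _ hfb)
  have if3 : Integrable f μ := Integrable.of_bound hf.aestronglyMeasurable M (ae_of_all _ hfb)
  have il : Integrable (fun x => Real.log (f x)) ν :=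
    Integrable.of_bound hf.log.aestronglyMeasurable _ (ae_of_all _ fun x => log_bdd hε (hfε x) (hfM x))
  have main : ∀ δ, 0 < δ → ∫ x, Real.log (f x) ∂ν - ∫ x, f x ∂μ + 1 ≤ C0 + (1/ε + 1) * δ := by
    intro δ hδ
    obtain ⟨h, hh1, hh2⟩ := if1.exists_boundedContinuous_integral_sub_le hδ
    set k : ℝ → ℝ := fun x => max ε (h x) with hk
    have hkc : Continuous k := continuous_const.max h.continuous
    have hkε : ∀ x, ε ≤ k x := fun x => le_max_left _ _
    have hU := U1 ν μ hν hμ C0 hp k hkc ε hε hkε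
    have hd : ∀ x, |f x - k x| ≤ ‖f x - h x‖ := by
      intro x
      rw [Real.norm_eq_abs, hk]
      simp only
      have := hfε x
      rcases le_total ε (h x) with h' | h'
      · rw [max_eq_right h']
      · rw [max_eq_left h', abs_of_nonneg (by linarith), abs_of_nonneg (by linarith)]; linarith
    have hab : Integrable (fun x => ‖f x - h x‖) (ν + μ) := (if1.sub hh2).norm
    have hab1 : Integrable (fun x => ‖f x - h x‖) ν := hab.left_of_add_measure
    have hab2 : Integrable (fun x => ‖f x - h x‖) μ := hab.right_of_add_measure
    rw [integral_add_measure hab1 hab2] at hh1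
    have n1 : 0 ≤ ∫ x, ‖f x - h x‖ ∂ν := integral_nonneg fun x => norm_nonneg _
    have n2 : 0 ≤ ∫ x, ‖f x - h x‖ ∂μ := integral_nonneg fun x => norm_nonneg _
    have ik : Integrable k μ := integrable_of_cont μ hμ _ hkc.continuousOn
    have ikl : Integrable (fun x => Real.log (k x)) ν :=
      integrable_of_cont ν hν _ (hkc.continuousOn.log fun x hx => by linarith [hkε x])
    have e1 : ∫ x, Real.log (f x) ∂ν ≤ ∫ x, (Real.log (k x) + 1/ε * ‖f x - h x‖) ∂ν := by
      apply integral_mono il (ikl.add (hab1.const_mul _))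
      intro x
      have kp : 0 < k x := by linarith [hkε x]
      have a := log_sub_le (by linarith [hfε x] : 0 < f x) kp
      have b : (f x - k x)/k x ≤ 1/ε * ‖f x - h x‖ := by
        calc (f x - k x)/k x ≤ ‖f x - h x‖ / k x := by
              gcongr; exact (le_abs_self _).trans (hd x)
          _ ≤ ‖f x - h x‖ / ε := by gcongr; exact hkε x
          _ = _ := by ring
      simp only [Pi.add_apply]; linarith
    have e2 : ∫ x, k x ∂μ ≤ ∫ x, (f x + ‖f x - h x‖) ∂μ := by
      apply integral_mono ik (if3.add hab2)
      intro x
      have := (abs_le.mp (hd x)).1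
      simp only [Pi.add_apply]; linarith
    rw [integral_add ikl (hab1.const_mul _), integral_const_mul] at e1
    rw [integral_add if3 hab2] at e2
    have : 1/ε * ∫ x, ‖f x - h x‖ ∂ν ≤ 1/ε * δ := by gcongr; linarith
    linarith
  have hK : 0 < 1/ε + 1 := by positivity
  apply le_of_forall_pos_le_add
  intro η hη
  have := main (η/(1/ε+1)) (by positivity)
  rwa [mul_div_cancel₀ _ hK.ne'] at this

lemma U3 (hν : ν (Icc (-2) 2)ᶜ = 0) (hμ : μ (Icc (-2) 2)ᶜ = 0) (C0 : ℝ)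
    (hp : ∀ p : ℝ[X], (∀ x ∈ Icc (-2:ℝ) 2, 0 < p.eval x) →
      ∫ x, Real.log (p.eval x) ∂ν - ∫ x, p.eval x ∂μ + 1 ≤ C0) : ν ≪ μ := by
  apply Measure.AbsolutelyContinuous.mk
  intro S hS hS0
  by_contra hne
  have hpos : 0 < ν.real S := by
    rw [measureReal_def]; exact ENNReal.toReal_pos hne (measure_ne_top _ _)
  obtain ⟨N, hN⟩ := exists_nat_gt (C0 / ν.real S)
  have hN' : C0 < N * ν.real S := by rwa [div_lt_iff₀ hpos] at hN
  have := U2 ν μ hν hμ C0 hp (fun x => Real.exp (S.indicator (fun _ => (N:ℝ)) x))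
    ((measurable_const.indicator hS).exp) 1 (Real.exp N) one_pos
    (by
      intro x
      rw [Real.one_le_exp_iff]
      exact indicator_nonneg (fun _ _ => by positivity) x)
    (by
      intro x
      rw [Real.exp_le_exp]
      by_cases hx : x ∈ S
      · simp [hx]
      · simp [hx])
  simp only [Real.log_exp] at this
  rw [integral_indicator_const _ hS] at this
  have e : ∫ x, Real.exp (S.indicator (fun _ => (N:ℝ)) x) ∂μ = 1 := by
    have : ∀ᵐ x ∂μ, Real.exp (S.indicator (fun _ => (N:ℝ)) x) = 1 := by
      have h : ∀ᵐ x ∂μ, x ∉ S := by rw [ae_iff]; simpa using hS0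
      filter_upwards [h] with x hx
      simp [hx]
    rw [integral_congr_ae this]; simp
  rw [e, smul_eq_mul] at this
  linarith

lemma clamp_nonneg (r N : ℝ) (hr : 0 ≤ r) (hN : 1 ≤ N) :
    0 ≤ r * Real.log (max N⁻¹ (min r N)) + 1 - max N⁻¹ (min r N) := by
  have hN0 : 0 < N := by linarith
  have hNi : N⁻¹ ≤ 1 := inv_le_one_of_one_le₀ hN
  have key : ∀ f, 0 < f → 0 ≤ f * Real.log f + 1 - f := fun f hf => InformationTheory.klFun_nonneg hf.le
  rcases le_total r N with h | h
  · rw [min_eq_left h]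
    rcases le_total N⁻¹ r with h' | h'
    · rw [max_eq_right h']
      exact key r (lt_of_lt_of_le (by positivity) h')
    · rw [max_eq_left h']
      have h1 := key N⁻¹ (by positivity)
      have h2 : Real.log N⁻¹ ≤ 0 := Real.log_nonpos (by positivity) hNi
      nlinarith
  · rw [min_eq_right h, max_eq_right (by linarith)]
    have h1 := key N hN0
    have h2 : 0 ≤ Real.log N := Real.log_nonneg hN
    nlinarith

lemma clamp_tendsto (r : ℝ) (hr : 0 ≤ r) :
    Tendsto (fun k : ℕ => r * Real.log (max ((k:ℝ)+1)⁻¹ (min r ((k:ℝ)+1))) + 1 - max ((k:ℝ)+1)⁻¹ (min r ((k:ℝ)+1)))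
      atTop (𝓝 (InformationTheory.klFun r)) := by
  have ht : Tendsto (fun k : ℕ => ((k:ℝ)+1)⁻¹) atTop (𝓝 0) := by
    have := tendsto_one_div_add_atTop_nhds_zero_nat (𝕜 := ℝ)
    simpa using this
  rcases hr.eq_or_lt with h | h
  · subst h
    have e : ∀ k : ℕ, max ((k:ℝ)+1)⁻¹ (min 0 ((k:ℝ)+1)) = ((k:ℝ)+1)⁻¹ := by
      intro k
      rw [min_eq_left (by positivity), max_eq_left (by positivity)]
    simp only [e]
    have := (ht.const_sub 1)
    simpa [InformationTheory.klFun] using this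
  · apply tendsto_const_nhds.congr'
    have h1 : ∀ᶠ k : ℕ in atTop, ((k:ℝ)+1)⁻¹ < r := ht.eventually_lt_const h
    have h2 : ∀ᶠ k : ℕ in atTop, r < (k:ℝ) := tendsto_natCast_atTop_atTop.eventually_gt_atTop r
    filter_upwards [h1, h2] with k hk1 hk2
    rw [min_eq_left (by linarith), max_eq_right hk1.le]; rfl

lemma KL_upper (hν : ν (Icc (-2) 2)ᶜ = 0) (hμ : μ (Icc (-2) 2)ᶜ = 0) (C0 : ℝ)
    (hp : ∀ p : ℝ[X], (∀ x ∈ Icc (-2:ℝ) 2, 0 < p.eval x) →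
      ∫ x, Real.log (p.eval x) ∂ν - ∫ x, p.eval x ∂μ + 1 ≤ C0) :
    KLdiv ν μ ≤ ENNReal.ofReal C0 := by
  have hac := U3 ν μ hν hμ C0 hp
  rw [KLdiv_eq, InformationTheory.klDiv_eq_lintegral_klFun_of_ac hac]
  set r : ℝ → ℝ := fun x => (ν.rnDeriv μ x).toReal with hr
  have hrm : Measurable r := (Measure.measurable_rnDeriv ν μ).ennreal_toReal
  set f : ℕ → ℝ → ℝ := fun k x => max ((k:ℝ)+1)⁻¹ (min (r x) ((k:ℝ)+1)) with hf
  have hfm : ∀ k, Measurable (f k) := fun k => by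
    simp only [hf]; exact measurable_const.max (hrm.min measurable_const)
  set G : ℕ → ℝ → ℝ := fun k x => r x * Real.log (f k x) + 1 - f k x with hG
  have hGm : ∀ k, Measurable (G k) := fun k =>
    (((hrm.mul (hfm k).log).add measurable_const).sub (hfm k))
  have hbd : ∀ k : ℕ, ∫⁻ x, ENNReal.ofReal (G k x) ∂μ ≤ ENNReal.ofReal C0 := by
    intro k
    have hε : (0:ℝ) < ((k:ℝ)+1)⁻¹ := by positivity
    have hk1 : (1:ℝ) ≤ (k:ℝ)+1 := by linarith [Nat.cast_nonneg (α := ℝ) k]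
    have hfε : ∀ x, ((k:ℝ)+1)⁻¹ ≤ f k x := fun x => le_max_left _ _
    have hfM : ∀ x, f k x ≤ (k:ℝ)+1 := fun x =>
      max_le ((inv_le_one_of_one_le₀ hk1).trans hk1) (min_le_right _ _)
    have hU := U2 ν μ hν hμ C0 hp (f k) (hfm k) _ _ hε hfε hfM
    have il : Integrable (fun x => Real.log (f k x)) ν :=
      Integrable.of_bound (hfm k).log.aestronglyMeasurable _ (ae_of_all _ fun x => log_bdd hε (hfε x) (hfM x))
    have if3 : Integrable (f k) μ := Integrable.of_bound (hfm k).aestronglyMeasurable ((k:ℝ)+1)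
      (ae_of_all _ fun x => by
        rw [Real.norm_eq_abs, abs_of_pos (by linarith [hfε x])]; exact hfM x)
    have ir := (integrable_rnDeriv_smul_iff hac).mpr il
    have eir := integral_rnDeriv_smul (f := fun x => Real.log (f k x)) hac
    rw [← ofReal_integral_eq_lintegral_ofReal]
    · apply ENNReal.ofReal_le_ofReal
      refine le_trans (le_of_eq ?_) hU
      rw [← eir]
      have := integral_sub (ir.add (integrable_const (1:ℝ))) if3
      rw [integral_add' ir (integrable_const (1:ℝ))] at this
      simp only [integral_const, probReal_univ, one_smul] at this
      rw [show ∀ a b : ℝ, a - b + 1 = a + 1 - b by intros; ring, ← this]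
      rfl
    · exact (ir.add (integrable_const (1:ℝ))).sub if3
    · exact ae_of_all _ fun x => clamp_nonneg _ _ ENNReal.toReal_nonneg hk1
  calc ∫⁻ x, ENNReal.ofReal (InformationTheory.klFun (r x)) ∂μ
      = ∫⁻ x, liminf (fun k => ENNReal.ofReal (G k x)) atTop ∂μ := by
        apply lintegral_congr
        intro x
        exact (((ENNReal.continuous_ofReal.tendsto _).comp
          (clamp_tendsto (r x) ENNReal.toReal_nonneg)).liminf_eq).symm
    _ ≤ liminf (fun k => ∫⁻ x, ENNReal.ofReal (G k x) ∂μ) atTop :=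
        lintegral_liminf_le fun k => (hGm k).ennreal_ofReal
    _ ≤ ENNReal.ofReal C0 := by
        refine (liminf_le_liminf (Eventually.of_forall hbd)).trans ?_
        simp

end upper

/-! ### Part I: assembly -/

lemma two_cos_mem (φ : ℝ) : 2 * Real.cos φ ∈ Icc (-2:ℝ) 2 :=
  ⟨by linarith [Real.neg_one_le_cos φ], by linarith [Real.cos_le_one φ]⟩

lemma wg_cos_cont (g : ℝ) : Continuous fun φ : ℝ => wg g (2 * Real.cos φ) := by unfold wg; fun_prop

lemma rho_logw (g : ℝ) (h1 : -1 ≤ g) (h2 : g ≤ 0) :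
    Continuous (fun φ : ℝ => wg g (2 * Real.cos φ) * Real.log (wg g (2 * Real.cos φ))) ∧
    Integrable (fun x => Real.log (wg g x)) (rhog g) ∧
    ∫ x, Real.log (wg g x) ∂(rhog g) = Hgw g := by
  have hc : Continuous (fun φ : ℝ => wg g (2 * Real.cos φ) * Real.log (wg g (2 * Real.cos φ))) :=
    Real.continuous_mul_log.comp (wg_cos_cont g)
  obtain ⟨a, b⟩ := rho_int g h1 h2 (fun x => Real.log (wg g x))
    (Measurable.log (by unfold wg; fun_prop)) hc
  exact ⟨hc, a, b.trans (avg_wlogw g h1 h2)⟩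

lemma rho_logc (g : ℝ) (h1 : -1 ≤ g) (h2 : g ≤ 0) (f : ℝ → ℝ) (hf : Continuous f)
    (hp : ∀ x ∈ Icc (-2:ℝ) 2, 0 < f x) :
    Continuous (fun φ : ℝ => wg g (2 * Real.cos φ) * Real.log (f (2 * Real.cos φ))) ∧
    Integrable (fun x => Real.log (f x)) (rhog g) ∧
    ∫ x, Real.log (f x) ∂(rhog g) =
      circleAverage (fun z : ℂ => wg g (2 * z.re) * Real.log (f (2 * z.re))) 0 1 := by
  have hc : Continuous (fun φ : ℝ => wg g (2 * Real.cos φ) * Real.log (f (2 * Real.cos φ))) := by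
    apply (wg_cos_cont g).mul
    apply Continuous.log (hf.comp (by fun_prop))
    intro φ; exact (hp _ (two_cos_mem φ)).ne'
  exact ⟨hc, rho_int g h1 h2 (fun x => Real.log (f x)) hf.measurable.log hc⟩

def csum (v : ℕ → ℝ) (n : ℕ) : ℝ := ∑ k ∈ Finset.range n, v k * v (k+1)

def kap (g : ℝ) (v : ℕ → ℝ) (n : ℕ) : ℝ := Hgw g + g * csum v n - Real.log (dprod v n)

lemma v_le_one (v : ℕ → ℝ) (h0 : v 0 = -1) (hv : ∀ n, |v (n+1)| < 1) (n : ℕ) : |v n| ≤ 1 := by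
  rcases n with _ | n
  · rw [h0]; simp
  · exact (hv n).le

lemma gvv (g : ℝ) (h1 : -1 ≤ g) (h2 : g ≤ 0) (v : ℕ → ℝ) (h0 : v 0 = -1) (hv : ∀ n, |v (n+1)| < 1) (n : ℕ) :
    0 < 1 - g * (v n * v (n+1)) ∧ 1 - g * (v n * v (n+1)) ≤ 2 := by
  have : |g * (v n * v (n+1))| < 1 := by
    rw [abs_mul, abs_mul]
    have a : |g| ≤ 1 := by rw [abs_le]; constructor <;> linarith
    have b := v_le_one v h0 hv n
    have c := hv n
    calc |g| * (|v n| * |v (n+1)|) ≤ 1 * (1 * |v (n+1)|) := by gcongr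
      _ < 1 := by simpa using c
  rw [abs_lt] at this
  constructor <;> linarith

lemma lower_n (g : ℝ) (h1 : -1 ≤ g) (h2 : g ≤ 0)
    (μ : Measure ℝ) [IsProbabilityMeasure μ] (hsupp : μ (Icc (-2) 2)ᶜ = 0)
    (v : ℕ → ℝ) (H : MomHyp μ v) (n : ℕ) :
    ENNReal.ofReal (kap g v n - Real.log (1 - g * (v n * v (n+1)))) ≤ KLdiv (rhog g) μ := by
  haveI := rho_prob g h1 h2
  have hE1 := (gvv g h1 h2 v H.v0 H.vlt n).1
  have hd := dprod_pos v H.vlt n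
  set E := dprod v n * (1 - g * (v n * v (n+1))) with hE
  have hEp : 0 < E := mul_pos hd hE1
  have hDp := dd_pos v H.v0 H.vlt n
  obtain ⟨-, a1, a2⟩ := rho_logw g h1 h2
  obtain ⟨-, b1, b2⟩ := rho_logc g h1 h2 (DD v n) (DD_cont v n) hDp
  rw [avg_log_dd v H.v0 H.vlt g n] at b2
  have hmi : ∀ᵐ x ∂μ, x ∈ Icc (-2:ℝ) 2 := hsupp
  have hae : (fun x => Real.log (wg g x * DD v n x / E)) =ᵐ[rhog g]
      fun x => Real.log (wg g x) + Real.log (DD v n x) - Real.log E := by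
    filter_upwards [rho_ae g h1 h2] with x hx
    have p1 := wg_pos g h1 h2 x hx
    have p2 := hDp x (Ioo_subset_Icc_self hx)
    rw [Real.log_div (by positivity) hEp.ne', Real.log_mul p1.ne' p2.ne']
  have hint : Integrable (fun x => Real.log (wg g x) + Real.log (DD v n x) - Real.log E) (rhog g) :=
    (a1.add b1).sub (integrable_const _)
  have hwc : Continuous (wg g) := by unfold wg; fun_prop
  have key := KL_lower (rhog g) μ (fun x => wg g x * DD v n x / E)
    (by
      filter_upwards [rho_ae g h1 h2] with x hx
      have p1 := wg_pos g h1 h2 x hx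
      have p2 := hDp x (Ioo_subset_Icc_self hx)
      positivity)
    (by
      filter_upwards [hmi] with x hx
      have p1 := wg_nonneg g h1 h2 x hx
      have p2 := hDp x hx
      positivity)
    ((integrable_of_cont μ hsupp _ (hwc.mul (DD_cont v n)).continuousOn).div_const E)
    (by rw [integral_div, wg_dd μ hsupp v H g n, div_self hEp.ne'])
    (hint.congr hae.symm)
  refine le_trans (le_of_eq ?_) key
  congr 1
  rw [integral_congr_ae hae]
  have e := integral_sub (a1.add b1) (integrable_const (Real.log E))
  rw [integral_add' a1 b1, a2, b2] at e
  simp only [integral_const, probReal_univ, one_smul] at e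
  refine Eq.trans ?_ e.symm
  rw [hE, Real.log_mul hd.ne' hE1.ne', kap, csum]
  ring

lemma upper_n (g : ℝ) (h1 : -1 ≤ g) (h2 : g ≤ 0)
    (μ : Measure ℝ) [IsProbabilityMeasure μ] (hsupp : μ (Icc (-2) 2)ᶜ = 0)
    (v : ℕ → ℝ) (H : MomHyp μ v) (n : ℕ) (p : ℝ[X]) (hpn : p.natDegree ≤ n + 1)
    (hp : ∀ x ∈ Icc (-2:ℝ) 2, 0 < p.eval x) :
    ∫ x, Real.log (p.eval x) ∂(rhog g) - ∫ x, p.eval x ∂μ + 1 ≤ kap g v n := by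
  haveI := rho_prob g h1 h2
  have hd := dprod_pos v H.vlt n
  have hDp := dd_pos v H.v0 H.vlt n
  obtain ⟨a0, a1, a2⟩ := rho_logw g h1 h2
  obtain ⟨b0, b1, b2⟩ := rho_logc g h1 h2 (DD v n) (DD_cont v n) hDp
  obtain ⟨c0, c1, c2⟩ := rho_logc g h1 h2 (fun x => p.eval x) p.continuous hp
  rw [avg_log_dd v H.v0 H.vlt g n] at b2
  have hwc : Continuous (wg g) := by unfold wg; fun_prop
  set h : ℝ → ℝ := fun x => Real.log (p.eval x) - Real.log (wg g x) - Real.log (DD v n x) + Real.log (dprod v n) with hh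
  have hhc : Continuous fun φ : ℝ => wg g (2 * Real.cos φ) * h (2 * Real.cos φ) := by
    have := ((c0.sub a0).sub b0).add ((wg_cos_cont g).mul (continuous_const (y := Real.log (dprod v n))))
    refine this.congr ?_
    intro φ; simp only [hh, Pi.add_apply, Pi.sub_apply, Pi.mul_apply]; ring
  have hhm : Measurable h := by
    simp only [hh]
    exact ((p.continuous.measurable.log.sub hwc.measurable.log).sub (DD_cont v n).measurable.log).add
      measurable_const
  obtain ⟨-, d2⟩ := rho_int g h1 h2 h hhm hhc
  have e := integral_add ((c1.sub a1).sub b1) (integrable_const (Real.log (dprod v n)))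
  rw [integral_sub' (c1.sub a1) b1, integral_sub' c1 a1, a2, b2] at e
  simp only [integral_const, probReal_univ, one_smul] at e
  have e' : ∫ x, h x ∂(rhog g) = ∫ x, Real.log (p.eval x) ∂(rhog g) - Hgw g - g * csum v n + Real.log (dprod v n) := e
  have hre : ∀ θ : ℝ, (circleMap 0 1 θ).re = Real.cos θ := by
    intro θ; simp [circleMap, Complex.exp_ofReal_mul_I_re]
  have ci1 : CircleIntegrable (fun z : ℂ => wg g (2 * z.re) * h (2 * z.re)) 0 1 := by
    unfold CircleIntegrable
    simp only [hre]
    exact hhc.intervalIntegrable _ _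
  have cc : ∀ z : ℂ, ‖z‖ = 1 → ContinuousAt (fun z : ℂ => p.eval (2 * z.re) / DD v n (2 * z.re)) z := by
    intro z hz
    have q2 : Continuous fun z : ℂ => DD v n (2 * z.re) := (DD_cont v n).comp (by fun_prop)
    have q1 : Continuous fun z : ℂ => p.eval (2 * z.re) := p.continuous.comp (by fun_prop)
    exact q1.continuousAt.div q2.continuousAt (dd_pos_circle v H.v0 H.vlt n hz).ne'
  have ci2 : CircleIntegrable (fun z : ℂ => dprod v n • (p.eval (2 * z.re) / DD v n (2 * z.re))) 0 1 :=
    circInt _ fun z hz => continuousAt_const.mul (cc z hz)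
  have ci3 : CircleIntegrable (fun z : ℂ => 1 + g * (z^2).re) 0 1 :=
    circInt _ fun z hz => by fun_prop
  have hm := circleAverage_mono (f₂ := fun z : ℂ => dprod v n • (p.eval (2 * z.re) / DD v n (2 * z.re))
      - (1 + g * (z^2).re)) ci1 (ci2.sub ci3) (by
    intro z hz
    have hz1 := sphere_norm hz
    have hx : 2 * z.re ∈ Icc (-2:ℝ) 2 := by
      have := Complex.abs_re_le_norm z
      rw [hz1, abs_le] at this
      constructor <;> linarith
    have hw0 := wg_nonneg g h1 h2 _ hx
    have hP := hp _ hx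
    have hD := hDp _ hx
    rw [← wg_circle g hz1]
    simp only [hh, smul_eq_mul]
    generalize 2 * z.re = x at *
    have hy : 0 < dprod v n * (p.eval x / DD v n x) := by positivity
    rcases hw0.eq_or_lt with hw | hw
    · rw [← hw]; simp only [zero_mul, sub_zero]; exact hy.le
    · have l := log_sub_le hy hw
      rw [Real.log_mul hd.ne' (by positivity), Real.log_div hP.ne' hD.ne'] at l
      have l2 := mul_le_mul_of_nonneg_left l hw.le
      rw [mul_div_cancel₀ _ hw.ne'] at l2
      linarith)
  rw [circleAverage_fun_sub ci2 ci3, avg_wg, circleAverage_fun_smul, poly_match μ hsupp v H n (n+1) le_rfl p hpn,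
    smul_eq_mul, mul_div_cancel₀ _ hd.ne', ← d2, e'] at hm
  unfold kap
  linarith

lemma upper_all (g : ℝ) (h1 : -1 ≤ g) (h2 : g ≤ 0)
    (μ : Measure ℝ) [IsProbabilityMeasure μ] (hsupp : μ (Icc (-2) 2)ᶜ = 0)
    (v : ℕ → ℝ) (H : MomHyp μ v) (C0 : ℝ) (hC : ∀ᶠ n in atTop, kap g v n ≤ C0) :
    KLdiv (rhog g) μ ≤ ENNReal.ofReal C0 := by
  haveI := rho_prob g h1 h2
  apply KL_upper _ _ (rho_supp g h1 h2) hsupp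
  intro p hp
  obtain ⟨n, hn1, hn2⟩ := (hC.and (eventually_ge_atTop p.natDegree)).exists
  exact (upper_n g h1 h2 μ hsupp v H n p (by omega) hp).trans hn1

lemma kap_nonneg (g : ℝ) (h1 : -1 ≤ g) (h2 : g ≤ 0)
    (μ : Measure ℝ) [IsProbabilityMeasure μ] (hsupp : μ (Icc (-2) 2)ᶜ = 0)
    (v : ℕ → ℝ) (H : MomHyp μ v) (n : ℕ) : 0 ≤ kap g v n := by
  have := upper_n g h1 h2 μ hsupp v H n 1 (by simp) (by simp)
  simpa using this

def tk (g : ℝ) (v : ℕ → ℝ) (k : ℕ) : ℝ :=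
  -(g/2) * (v (k+1) - v k)^2 + (-Real.log (1 - (v (k+1))^2) + g * (v (k+1))^2)

lemma neg_log_ge {y : ℝ} (h0 : 0 ≤ y) (h1 : y < 1) : y + y^2/2 ≤ -Real.log (1 - y) := by
  have h := Real.hasSum_pow_div_log_of_abs_lt_one (x := y) (by rw [abs_of_nonneg h0]; exact h1)
  have := sum_le_hasSum (Finset.range 2) (fun i _ => by positivity) h
  simp [Finset.sum_range_succ] at this
  norm_num at this
  linarith

lemma tk_ge (g : ℝ) (h1 : -1 ≤ g) (v : ℕ → ℝ) (hv : ∀ n, |v (n+1)| < 1) (k : ℕ) :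
    ((v (k+1))^2)^2/2 ≤ -Real.log (1 - (v (k+1))^2) + g * (v (k+1))^2 := by
  have := neg_log_ge (sq_nonneg (v (k+1))) ((sq_lt_one_iff_abs_lt_one (v (k+1))).mpr (hv k))
  nlinarith [sq_nonneg (v (k+1))]

lemma kap_eq (g : ℝ) (v : ℕ → ℝ) (h0 : v 0 = -1) (hv : ∀ n, |v (n+1)| < 1) (n : ℕ) :
    kap g v n = (∑ k ∈ Finset.range n, tk g v k) + (Hgw g + g/2) + (-(g/2)) * (v n)^2 := by
  induction n with
  | zero => simp [kap, csum, dprod, h0]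
  | succ n ih =>
    have hd := dprod_pos v hv n
    have hp : 0 < 1 - (v (n+1))^2 := by
      have := (sq_lt_one_iff_abs_lt_one (v (n+1))).mpr (hv n); linarith
    rw [Finset.sum_range_succ]
    have : kap g v (n+1) = kap g v n + g * (v n * v (n+1)) - Real.log (1 - (v (n+1))^2) := by
      unfold kap csum
      rw [Finset.sum_range_succ, dprod_succ, Real.log_mul hd.ne' hp.ne']; ring
    rw [this, ih, tk]; ring

lemma H_nonpos (g : ℝ) (h1 : -1 ≤ g) (h2 : g ≤ 0) : Hgw g + g/2 ≤ 0 := by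
  unfold Hgw
  have hs : 1 + g ≤ Real.sqrt (1 - g^2) := by
    apply Real.le_sqrt_of_sq_le
    nlinarith
  have hs0 := Real.sqrt_nonneg (1 - g^2)
  have := Real.log_le_sub_one_of_pos (x := (1 + Real.sqrt (1 - g^2))/2) (by positivity)
  linarith

lemma main_aux (g : ℝ) (h1 : -1 ≤ g) (h2 : g ≤ 0)
    (μ : Measure ℝ) [IsProbabilityMeasure μ] (hsupp : μ (Icc (-2) 2)ᶜ = 0)
    (v : ℕ → ℝ) (H : MomHyp μ v) :
    KLdiv (rhog g) μ + ENNReal.ofReal (-(Hgw g + g/2)) = ∑' k, ENNReal.ofReal (tk g v k) := by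
  have hH := H_nonpos g h1 h2
  set h0 := -(Hgw g + g/2) with hh0
  have hh : 0 ≤ h0 := by linarith
  have htk2 : ∀ k, ((v (k+1))^2)^2/2 ≤ tk g v k := by
    intro k
    have := tk_ge g h1 v H.vlt k
    unfold tk
    nlinarith [sq_nonneg (v (k+1) - v k)]
  have htk : ∀ k, 0 ≤ tk g v k := fun k => le_trans (by positivity) (htk2 k)
  set S : ℕ → ℝ := fun n => ∑ k ∈ Finset.range n, tk g v k with hS
  have hS0 : ∀ n, 0 ≤ S n := fun n => Finset.sum_nonneg fun k _ => htk k
  have hkap : ∀ n, kap g v n = S n - h0 + (-(g/2)) * (v n)^2 := by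
    intro n; rw [kap_eq g v H.v0 H.vlt n, hS, hh0]; ring
  have hlow : ∀ n, ENNReal.ofReal (S n + (-(g/2)) * (v n)^2 - Real.log (1 - g * (v n * v (n+1)))) ≤
      KLdiv (rhog g) μ + ENNReal.ofReal h0 := by
    intro n
    have := lower_n g h1 h2 μ hsupp v H n
    refine le_trans ?_ (add_le_add_left this _)
    refine le_trans (ENNReal.ofReal_le_ofReal (le_of_eq ?_)) ENNReal.ofReal_add_le
    rw [hkap]; ring
  have hSe : ∀ n, ∑ k ∈ Finset.range n, ENNReal.ofReal (tk g v k) = ENNReal.ofReal (S n) := fun n =>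
    (ENNReal.ofReal_sum_of_nonneg fun k _ => htk k).symm
  by_cases hT : ∑' k, ENNReal.ofReal (tk g v k) = ⊤
  · rw [hT]
    have : ∑' k, ENNReal.ofReal (tk g v k) ≤
        KLdiv (rhog g) μ + ENNReal.ofReal h0 + ENNReal.ofReal (Real.log 2) := by
      rw [ENNReal.tsum_eq_iSup_nat]
      apply iSup_le
      intro n
      rw [hSe]
      refine le_trans ?_ (add_le_add_left (hlow n) _)
      refine le_trans (ENNReal.ofReal_le_ofReal ?_) ENNReal.ofReal_add_le
      obtain ⟨p1, p2⟩ := gvv g h1 h2 v H.v0 H.vlt n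
      have := Real.log_le_log p1 p2
      nlinarith [sq_nonneg (v n)]
    rw [hT, top_le_iff] at this
    by_contra hne
    exact (ENNReal.add_ne_top.mpr ⟨hne, ENNReal.ofReal_ne_top⟩) this
  · have hsum : Summable (tk g v) := by
      have := ENNReal.summable_toReal hT
      refine this.congr ?_
      intro k; exact (ENNReal.toReal_ofReal (htk k))
    have hST : Tendsto S atTop (𝓝 (∑' k, tk g v k)) := hsum.hasSum.tendsto_sum_nat
    rw [← ENNReal.ofReal_tsum_of_nonneg htk hsum]
    set τ := ∑' k, tk g v k with hτ
    have hSle : ∀ n, S n ≤ τ := fun n => hsum.sum_le_tsum _ fun k _ => htk k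
    have hv1 : Tendsto (fun k => v (k+1)) atTop (𝓝 0) := by
      have a : Tendsto (fun k => (v (k+1))^4) atTop (𝓝 0) := by
        have b := (hsum.tendsto_atTop_zero).const_mul 2
        rw [mul_zero] at b
        refine squeeze_zero (fun k => by positivity) (fun k => ?_) b
        have := htk2 k
        nlinarith
      have c : Tendsto (fun k => (v (k+1))^2) atTop (𝓝 0) := by
        have := (Real.continuous_sqrt.tendsto 0).comp a
        rw [Real.sqrt_zero] at this
        refine this.congr ?_
        intro k
        simp only [Function.comp]
        rw [show (v (k+1))^4 = ((v (k+1))^2)^2 by ring, Real.sqrt_sq (sq_nonneg _)]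
      have := (Real.continuous_sqrt.tendsto 0).comp c
      rw [Real.sqrt_zero] at this
      rw [tendsto_zero_iff_abs_tendsto_zero]
      refine this.congr ?_
      intro k
      simp only [Function.comp, Real.sqrt_sq_eq_abs]
    have hv0 : Tendsto v atTop (𝓝 0) := (tendsto_add_atTop_iff_nat 1).mp hv1
    have hkt : Tendsto (kap g v) atTop (𝓝 (τ - h0)) := by
      have := (hST.sub_const h0).add ((hv0.pow 2).const_mul (-(g/2)))
      have e : τ - h0 + -(g/2) * 0^2 = τ - h0 := by ring
      rw [e] at this
      exact this.congr fun n => (hkap n).symm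
    have hτh : 0 ≤ τ - h0 := ge_of_tendsto' hkt fun n => kap_nonneg g h1 h2 μ hsupp v H n
    apply le_antisymm
    · have hu : KLdiv (rhog g) μ ≤ ENNReal.ofReal (τ - h0) := by
        have : ∀ m : ℕ, KLdiv (rhog g) μ ≤ ENNReal.ofReal (τ - h0 + 1/((m:ℝ)+1)) := by
          intro m
          apply upper_all g h1 h2 μ hsupp v H
          apply hkt.eventually_le_const
          have : 0 < 1/((m:ℝ)+1) := by positivity
          linarith
        refine ge_of_tendsto' (x := atTop) ?_ this
        apply (ENNReal.continuous_ofReal.tendsto _).comp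
        have := (tendsto_one_div_add_atTop_nhds_zero_nat (𝕜 := ℝ)).const_add (τ - h0)
        rwa [add_zero] at this
      calc KLdiv (rhog g) μ + ENNReal.ofReal h0 ≤ ENNReal.ofReal (τ - h0) + ENNReal.ofReal h0 := by gcongr
        _ = ENNReal.ofReal τ := by rw [← ENNReal.ofReal_add hτh hh]; congr 1; ring
    · refine le_of_tendsto' (x := atTop) ?_ hlow
      apply (ENNReal.continuous_ofReal.tendsto _).comp
      have l1 : Tendsto (fun n => 1 - g * (v n * v (n+1))) atTop (𝓝 (1 - g * (0 * 0))) :=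
        ((hv0.mul hv1).const_mul g).const_sub 1
      have l2 := l1.log (by norm_num)
      have := (hST.add ((hv0.pow 2).const_mul (-(g/2)))).sub l2
      have e : τ + -(g/2) * 0^2 - Real.log (1 - g * (0*0)) = τ := by simp
      rw [e] at this
      exact this

/-- New sum rule obtained from the Gross–Witten sum rule via the Delsarte–Genin mapping.
The finite constant `H(g) + g/2 (≤ 0)` has been moved to the left-hand side. -/
theorem gw_dg_sum_rule (g : ℝ) (hg1 : -1 ≤ g) (hg0 : g ≤ 0)
    (μ : Measure ℝ) [IsProbabilityMeasure μ] (hsupp : μ (Icc (-2) 2)ᶜ = 0)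
    (hsym : μ.map (fun x => -x) = μ) (hnt : InfiniteSupport μ)
    (u : ℕ → ℝ) (hu : IsCanonicalMoments μ u) (hodd : ∀ k : ℕ, u (2*k+1) = 0) :
    KLdiv (rhog g) μ + ENNReal.ofReal (-(Hgw g + g/2)) =
      ENNReal.ofReal (-(g/2)) * ∑' k : ℕ, ENNReal.ofReal ((u (2*k+2) - u (2*k))^2)
      + ∑' k : ℕ, ENNReal.ofReal (-Real.log (1 - (u (2*k+2))^2) + g * (u (2*k+2))^2) := by
  have H := momHyp μ hsupp u hu hodd
  rw [main_aux g hg1 hg0 μ hsupp _ H, ← ENNReal.tsum_mul_left, ← ENNReal.tsum_add]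
  congr 1
  ext k
  have h2 := tk_ge g hg1 (fun k => u (2*k)) H.vlt k
  have h3 : 0 ≤ ((u (2*(k+1)))^2)^2/2 := by positivity
  rw [← ENNReal.ofReal_mul (by linarith), ← ENNReal.ofReal_add]
  · rfl
  · apply mul_nonneg (by linarith) (sq_nonneg _)
  · exact h3.trans h2

end SumRules
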